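/- arXiv:1906.00652 — 3 statements merged into one kernel-verified Lean document; each statement's English description precedes it below -/
import Mathlib

section
/- Let G be a connected graph on n vertices with r edges, and let J ⊆ k[X_1,…,X_n] be the squarefree monomial ideal generated by the monomials X_{[n]∖e} = ∏_{i∉e} X_i for edges e of G. Then the graded Betti numbers of J are β_{0,2} shifted appropriately: β_{0,n-2}(J) = r, β_{1,n-1}(J) = 2r - n, β_{2,n}(J) = r - n + 1, and all other graded Betti numbers of J vanish. -/
open MvPolynomial

open scoped Classical in
/-- `f`, an element of the free module with basis indexed by `Σ j, Fin (βi j)`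
(where the basis elements over `j` have degree `j`), is homogeneous of degree
`dg` for the weighted grading given by `w`. -/
def HomogOfDeg (k : Type*) [Field k] (n : ℕ) (w : Fin n → ℕ) (βi : ℕ → ℕ) (dg : ℕ)
    (f : ((j : ℕ) × Fin (βi j)) →₀ MvPolynomial (Fin n) k) : Prop :=
  ∀ p : (j : ℕ) × Fin (βi j),
    f p ∈ weightedHomogeneousSubmodule k w (dg - p.1) ∧ (dg < p.1 → f p = 0)

/-- `β : ℕ → ℕ → ℕ` is the table of graded Betti numbers of the graded module
`M` over `S = k[X_1,…,X_n]` (graded by `deg X_i = w i`, with `Hdeg d` the set of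
homogeneous elements of `M` of degree `d`): there is a minimal graded free
resolution of `M` whose `i`-th term has `β i j` basis elements of degree `j`.
Minimality is expressed by all matrix entries of the differentials having zero
constant term. -/
def IsMinimalGradedFreeResolution (k : Type*) [Field k] (n : ℕ) (w : Fin n → ℕ)
    (β : ℕ → ℕ → ℕ) (M : Type*) [AddCommGroup M]
    [Module (MvPolynomial (Fin n) k) M] (Hdeg : ℕ → Set M) : Prop :=
  ∃ (d : (i : ℕ) → (((j : ℕ) × Fin (β (i + 1) j)) →₀ MvPolynomial (Fin n) k)
        →ₗ[MvPolynomial (Fin n) k] (((j : ℕ) × Fin (β i j)) →₀ MvPolynomial (Fin n) k))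
    (ε : (((j : ℕ) × Fin (β 0 j)) →₀ MvPolynomial (Fin n) k) →ₗ[MvPolynomial (Fin n) k] M),
    Function.Surjective ε ∧
    LinearMap.ker ε = LinearMap.range (d 0) ∧
    (∀ i, LinearMap.ker (d i) = LinearMap.range (d (i + 1))) ∧
    (∀ i p q, constantCoeff (d i (Finsupp.single p 1) q) = 0) ∧
    (∀ i dg f, HomogOfDeg k n w (β (i + 1)) dg f → HomogOfDeg k n w (β i) dg (d i f)) ∧
    (∀ dg f, HomogOfDeg k n w (β 0) dg f → ε f ∈ Hdeg dg)

section MinimalCover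

variable {k : Type*} [Field k] {n : ℕ}

lemma constantCoeff_eq_zero_of_isWeightedHomogeneous {m : ℕ} (hm : m ≠ 0)
    {p : MvPolynomial (Fin n) k} (hp : IsWeightedHomogeneous (fun _ => 1 : Fin n → ℕ) p m) :
    constantCoeff p = 0 := by
  rw [constantCoeff_eq]
  exact hp.coeff_eq_zero 0 (by simpa using hm.symm)

lemma eq_C_of_isWeightedHomogeneous_zero
    {p : MvPolynomial (Fin n) k} (hp : IsWeightedHomogeneous (fun _ => 1 : Fin n → ℕ) p 0) :
    p = C (constantCoeff p) := by
  have h : p.IsHomogeneous 0 := hp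
  rw [constantCoeff_eq]
  exact totalDegree_eq_zero_iff_eq_C.1 ((totalDegree_zero_iff_isHomogeneous (p := p)).2 h)

open scoped Classical in
/-- The homogeneous components of a product with a homogeneous right factor. -/
lemma weightedHomogeneousComponent_mul_of_right {w : Fin n → ℕ} {e : ℕ}
    (a : MvPolynomial (Fin n) k) {b : MvPolynomial (Fin n) k}
    (hb : b ∈ weightedHomogeneousSubmodule k w e) (m : ℕ) :
    weightedHomogeneousComponent w m (a * b) =
      if e ≤ m then weightedHomogeneousComponent w (m - e) a * b else 0 := by
  let := weightedGradedAlgebra k w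
  have hd : ∀ (p : MvPolynomial (Fin n) k) i,
      (DirectSum.decompose (weightedHomogeneousSubmodule k w) p i : MvPolynomial (Fin n) k) =
        weightedHomogeneousComponent w i p :=
    fun p i => weightedDecomposition.decompose'_apply k w p i
  have := DirectSum.coe_decompose_mul_of_right_mem
    (weightedHomogeneousSubmodule k w) (a := a) m hb
  simpa only [hd] using this

lemma exists_homogeneous_coefficients {ι σ : Type*} [Fintype ι] {D e q : ℕ}
    {g : ι → σ → MvPolynomial (Fin n) k}
    (hg : ∀ j s, g j s ∈ weightedHomogeneousSubmodule k (fun _ => 1 : Fin n → ℕ) e)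
    {x : σ → MvPolynomial (Fin n) k}
    (hx : ∀ s, x s ∈ weightedHomogeneousSubmodule k (fun _ => 1 : Fin n → ℕ) (q - D) ∧
      (q < D → x s = 0))
    (hspan : ∃ c : ι → MvPolynomial (Fin n) k, x = ∑ j, c j • g j) :
    ∃ c : ι → MvPolynomial (Fin n) k, x = ∑ j, c j • g j ∧
      ∀ j, c j ∈ weightedHomogeneousSubmodule k (fun _ => 1 : Fin n → ℕ) (q - (D + e)) ∧
        (q < D + e → c j = 0) := by
  obtain ⟨c, hc⟩ := hspan
  by_cases hq : q < D + e
  · refine ⟨0, ?_, fun j => ⟨Submodule.zero_mem _, fun _ => rfl⟩⟩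
    funext s
    by_cases hD : q < D
    · simpa using (hx s).2 hD
    · have h1 := weightedHomogeneousComponent_of_mem (m := q - D) (n := q - D) (hx s).1
      rw [if_pos rfl, hc] at h1
      simp only [Finset.sum_apply, Pi.smul_apply, smul_eq_mul, map_sum] at h1
      rw [hc]
      simp only [Finset.sum_apply, Pi.smul_apply, smul_eq_mul, Pi.zero_apply, zero_mul]
      rw [← h1]
      refine Finset.sum_congr rfl fun j _ => ?_
      rw [weightedHomogeneousComponent_mul_of_right _ (hg j s), if_neg (by omega)]
  · refine ⟨fun j => weightedHomogeneousComponent _ (q - (D + e)) (c j), ?_, fun j =>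
      ⟨weightedHomogeneousComponent_mem _ _ _, fun h => absurd h hq⟩⟩
    funext s
    have h1 := weightedHomogeneousComponent_of_mem (m := q - D) (n := q - D) (hx s).1
    rw [if_pos rfl] at h1
    rw [← h1]
    conv_lhs => rw [hc]
    simp only [Finset.sum_apply, Pi.smul_apply, smul_eq_mul, map_sum]
    refine Finset.sum_congr rfl fun j _ => ?_
    rw [weightedHomogeneousComponent_mul_of_right _ (hg j s), if_pos (by omega), Nat.sub_sub]

lemma homogOfDeg_single {βi : ℕ → ℕ} (p : (j : ℕ) × Fin (βi j)) :
    HomogOfDeg k n (fun _ => 1) βi p.1 (Finsupp.single p 1) := by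
  classical
  intro q
  rcases eq_or_ne p q with rfl | h
  · simpa using isWeightedHomogeneous_one k (fun _ => 1 : Fin n → ℕ)
  · simp [Finsupp.single_eq_of_ne h.symm]

/-- A minimal graded cover of a module generated, minimally, by a finite family of homogeneous
elements of the same degree has one basis element for each element of the family. -/
lemma minimalCover_equiv {ι σ : Type*} [Fintype ι] {βi : ℕ → ℕ} {D e : ℕ}
    (ε : (((j : ℕ) × Fin (βi j)) →₀ MvPolynomial (Fin n) k)
      →ₗ[MvPolynomial (Fin n) k] (σ → MvPolynomial (Fin n) k))
    (g : ι → σ → MvPolynomial (Fin n) k)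
    (hrange : ∀ x, (∃ f, ε f = x) ↔ ∃ c : ι → MvPolynomial (Fin n) k, x = ∑ j, c j • g j)
    (hmin : ∀ c : ι → MvPolynomial (Fin n) k, ∑ j, c j • g j = 0 → ∀ j, constantCoeff (c j) = 0)
    (hker : ∀ f, ε f = 0 → ∀ p, constantCoeff (f p) = 0)
    (hhom : ∀ dg f, HomogOfDeg k n (fun _ => 1) βi dg f → ∀ s,
      ε f s ∈ weightedHomogeneousSubmodule k (fun _ => 1 : Fin n → ℕ) (dg - D) ∧
        (dg < D → ε f s = 0))
    (hg : ∀ j s, g j s ∈ weightedHomogeneousSubmodule k (fun _ => 1 : Fin n → ℕ) e) :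
    (∀ j, βi j ≠ 0 → j = D + e) ∧ βi (D + e) = Fintype.card ι ∧
    ∃ φ : (((j : ℕ) × Fin (βi j)) →₀ MvPolynomial (Fin n) k)
      ≃ₗ[MvPolynomial (Fin n) k] (ι → MvPolynomial (Fin n) k),
      (∀ f, ε f = ∑ j, φ f j • g j) ∧
      ∀ dg f, HomogOfDeg k n (fun _ => 1) βi dg f → ∀ s,
        φ f s ∈ weightedHomogeneousSubmodule k (fun _ => 1 : Fin n → ℕ) (dg - (D + e)) ∧
          (dg < D + e → φ f s = 0) := by
  classical
  have hc := fun p : (j : ℕ) × Fin (βi j) =>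
    exists_homogeneous_coefficients hg (hhom p.1 _ (homogOfDeg_single p)) ((hrange _).1 ⟨_, rfl⟩)
  choose c hc hchom using hc
  have hψ : ∀ j, ∃ f, ε f = g j := fun j =>
    (hrange _).2 ⟨Pi.single j 1, by simp [Pi.single_apply, ite_smul]⟩
  choose ψ hψ using hψ
  have hrel : ∀ p p', (if p = p' then (1 : k) else 0) =
      ∑ j, constantCoeff (c p j) * constantCoeff (ψ j p') := by
    intro p p'
    have h0 : ε (Finsupp.single p 1 - ∑ j, c p j • ψ j) = 0 := by
      simp [hψ, hc, map_sum]
    have h1 := hker _ h0 p'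
    simp only [Finsupp.coe_sub, Pi.sub_apply, Finsupp.single_apply, Finsupp.finsetSum_apply,
      Finsupp.smul_apply, smul_eq_mul, map_sub, map_sum, map_mul, sub_eq_zero] at h1
    rw [← h1]
    split_ifs <;> simp
  have hdeg : ∀ p : (j : ℕ) × Fin (βi j), p.1 = D + e := by
    intro p
    by_contra hp
    have h1 := hrel p p
    rw [if_pos rfl, Finset.sum_eq_zero] at h1
    · exact one_ne_zero h1
    · intro j _
      rcases lt_or_gt_of_ne hp with h | h
      · simp [(hchom p j).2 h]
      · rw [constantCoeff_eq_zero_of_isWeightedHomogeneous (m := p.1 - (D + e)) (by omega)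
          (hchom p j).1, zero_mul]
  have hcC : ∀ p j, c p j = C (constantCoeff (c p j)) := fun p j =>
    eq_C_of_isWeightedHomogeneous_zero (by simpa [hdeg p] using (hchom p j).1)
  let φ := Finsupp.linearCombination (MvPolynomial (Fin n) k) c
  have hεφ : ∀ f, ε f = ∑ j, φ f j • g j := by
    intro f
    induction f using Finsupp.induction_linear with
    | zero => simp
    | add x y hx hy => simp [hx, hy, add_smul, Finset.sum_add_distrib]
    | single p a =>
      have : Finsupp.single p a = a • Finsupp.single p (1 : MvPolynomial (Fin n) k) := by simp
      rw [this, map_smul, map_smul, hc]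
      simp [φ, Finset.smul_sum, mul_smul]
  let u : ι → (((j : ℕ) × Fin (βi j)) →₀ MvPolynomial (Fin n) k) := fun j =>
    (ψ j).mapRange (fun a => C (constantCoeff a)) (by simp)
  let χ : (ι → MvPolynomial (Fin n) k) →ₗ[MvPolynomial (Fin n) k] _ :=
    Fintype.linearCombination (MvPolynomial (Fin n) k) u
  have hφu : ∀ j, φ (u j) = fun j' => C (constantCoeff (φ (ψ j) j')) := by
    intro j
    funext j'
    have h1 : φ (u j) j' = ∑ p ∈ (ψ j).support, C (constantCoeff (ψ j p)) * c p j' := by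
      simp only [φ, Finsupp.linearCombination_apply]
      rw [Finsupp.sum_of_support_subset _ Finsupp.support_mapRange _ (by simp)]
      simp
    have h2 : φ (ψ j) j' = ∑ p ∈ (ψ j).support, ψ j p * c p j' := by
      simp [φ, Finsupp.linearCombination_apply, Finsupp.sum]
    rw [h1, h2, map_sum, map_sum]
    refine Finset.sum_congr rfl fun p _ => ?_
    rw [map_mul, map_mul, ← hcC]
  have hleft : χ ∘ₗ φ = LinearMap.id := by
    refine Finsupp.lhom_ext' fun p => LinearMap.ext_ring ?_
    ext1 p'
    have := hrel p p'
    simp only [LinearMap.coe_comp, Function.comp_apply, Finsupp.lsingle_apply, φ, χ,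
      Finsupp.linearCombination_single, one_smul, Fintype.linearCombination_apply,
      LinearMap.id_coe, id_eq, Finsupp.finsetSum_apply, Finsupp.smul_apply, smul_eq_mul, u,
      Finsupp.mapRange_apply, Finsupp.single_apply]
    calc _ = C (∑ j, constantCoeff (c p j) * constantCoeff (ψ j p')) := by
          simp [map_sum, ← hcC]
      _ = _ := by rw [← this]; split_ifs <;> simp
  have hright : φ ∘ₗ χ = LinearMap.id := by
    refine LinearMap.pi_ext' fun j => LinearMap.ext_ring ?_
    have hχ : χ (Pi.single j 1) = u j := by
      simp [χ]
    have h0 : ∑ j', (φ (ψ j) - Pi.single j 1 : ι → MvPolynomial (Fin n) k) j' • g j' = 0 := by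
      simp only [Pi.sub_apply, sub_smul, Finset.sum_sub_distrib, ← hεφ, hψ]
      simp [Pi.single_apply, ite_smul]
    have h1 := hmin _ h0
    simp only [LinearMap.coe_comp, Function.comp_apply, LinearMap.coe_single, hχ, hφu,
      LinearMap.id_coe, id_eq]
    funext j'
    have h2 := h1 j'
    simp only [Pi.sub_apply, map_sub, sub_eq_zero] at h2
    rw [h2, Pi.single_apply]
    split_ifs <;> simp
  let Φ : (((j : ℕ) × Fin (βi j)) →₀ MvPolynomial (Fin n) k)
      ≃ₗ[MvPolynomial (Fin n) k] (ι → MvPolynomial (Fin n) k) :=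
    LinearEquiv.ofLinearMap φ χ hright hleft
  refine ⟨fun j hj => hdeg ⟨j, ⟨0, Nat.pos_of_ne_zero hj⟩⟩, ?_, Φ, hεφ, ?_⟩
  · let E : Fin (βi (D + e)) ≃ ((j : ℕ) × Fin (βi j)) :=
      Equiv.ofBijective (fun i => ⟨D + e, i⟩) ⟨fun a b h => by simpa using h, fun ⟨j, i⟩ => by
        obtain rfl : j = D + e := hdeg ⟨j, i⟩
        exact ⟨i, rfl⟩⟩
    have := ((Finsupp.domLCongr (R := MvPolynomial (Fin n) k)
      (M := MvPolynomial (Fin n) k) E).trans Φ).finrank_eq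
    simpa using this
  · intro dg f hf s
    have h2 : φ f s = ∑ p ∈ f.support, f p * c p s := by
      simp [φ, Finsupp.linearCombination_apply, Finsupp.sum]
    change φ f s ∈ _ ∧ (_ → φ f s = 0)
    rw [h2]
    refine ⟨Submodule.sum_mem _ fun p _ => ?_, fun h => Finset.sum_eq_zero fun p _ => ?_⟩
    · rw [hcC p s, mul_comm, ← smul_eq_C_mul, ← hdeg p]
      exact Submodule.smul_mem _ _ (hf p).1
    · rw [(hf p).2 (by rw [hdeg p]; exact h), zero_mul]

end MinimalCover

section KernelMatrices

open Matrix

/-- Over a field, the kernel of a matrix is the split image of an injective matrix. -/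
lemma Matrix.exists_kernel_matrices {k m d : Type*} [Field k] [Fintype m] [Fintype d]
    [DecidableEq m] [DecidableEq d] (N : Matrix m d k) {b : ℕ}
    (hb : Module.finrank k (LinearMap.ker N.mulVecLin) = b) :
    ∃ (z : Matrix d (Fin b) k) (q : Matrix (Fin b) d k) (s : Matrix d m k),
      N * z = 0 ∧ q * z = 1 ∧ z * q + s * N = 1 := by
  let K := LinearMap.ker N.mulVecLin
  let e : K ≃ₗ[k] (Fin b → k) := LinearEquiv.ofFinrankEq _ _ (by simpa using hb)
  obtain ⟨p, hp⟩ := LinearMap.exists_leftInverse_of_injective K.subtype K.ker_subtype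
  obtain ⟨t, ht⟩ := LinearMap.exists_rightInverse_of_surjective N.mulVecLin.rangeRestrict
    (LinearMap.range_rangeRestrict _)
  obtain ⟨t', ht'⟩ := LinearMap.exists_extend t
  have hp' : ∀ x : K, p x = x := fun x => LinearMap.congr_fun hp x
  have ht2 : ∀ x, N *ᵥ (t' (N *ᵥ x)) = N *ᵥ x := by
    intro x
    have h1 := LinearMap.congr_fun ht' ⟨N *ᵥ x, ⟨x, rfl⟩⟩
    have h2 := congrArg Subtype.val (LinearMap.congr_fun ht ⟨N *ᵥ x, ⟨x, rfl⟩⟩)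
    simp only [LinearMap.comp_apply, Submodule.subtype_apply] at h1
    rw [h1]
    exact h2
  let s := (LinearMap.id - K.subtype ∘ₗ p) ∘ₗ t'
  refine ⟨LinearMap.toMatrix' (K.subtype ∘ₗ e.symm.toLinearMap),
    LinearMap.toMatrix' (e.toLinearMap ∘ₗ p), LinearMap.toMatrix' s, ?_, ?_, ?_⟩
  · apply Matrix.toLin'.injective
    ext x : 1
    refine LinearMap.ext_ring ?_
    simp only [toLin'_mul, toLin'_toMatrix', map_zero, LinearMap.comp_apply]
    exact (e.symm _).2
  · apply Matrix.toLin'.injective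
    ext x : 1
    refine LinearMap.ext_ring ?_
    simp only [toLin'_mul, toLin'_toMatrix', toLin'_one, LinearMap.comp_apply,
      Submodule.subtype_apply, LinearEquiv.coe_coe, hp', LinearEquiv.apply_symm_apply,
      LinearMap.id_apply]
  · apply Matrix.toLin'.injective
    refine LinearMap.ext fun x => ?_
    have hx : x - t' (N *ᵥ x) ∈ K := by
      simp only [K, LinearMap.mem_ker, mulVecLin_apply, mulVec_sub, ht2, sub_self]
    have h1 := congrArg Subtype.val (hp' ⟨_, hx⟩)
    simp only [map_sub, AddSubgroupClass.coe_sub] at h1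
    simp only [map_add, toLin'_mul, toLin'_toMatrix', toLin'_one, LinearMap.comp_apply,
      LinearMap.add_apply, Submodule.subtype_apply, LinearEquiv.coe_coe,
      LinearEquiv.symm_apply_apply, LinearMap.id_apply, toLin'_apply, s, LinearMap.sub_apply]
    rw [add_comm, sub_add_eq_add_sub, add_sub_assoc, h1]
    abel

end KernelMatrices

namespace SimpleGraph

open Matrix

open scoped Classical in
/-- The vertex-dart incidence matrix, recording the source of each dart. -/
noncomputable def dartSource {V : Type*} (G : SimpleGraph V) (R : Type*) [CommRing R] :
    Matrix V G.Dart R :=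
  Matrix.of fun v d => if d.fst = v then 1 else 0

open scoped Classical in
/-- The edge-dart incidence matrix, recording the underlying edge of each dart. -/
noncomputable def dartEdge {V : Type*} (G : SimpleGraph V) (R : Type*) [CommRing R] :
    Matrix G.edgeSet G.Dart R :=
  Matrix.of fun e d => if d.edge = (e : Sym2 V) then 1 else 0

section Incidence

variable {V : Type*} {G : SimpleGraph V} {R : Type*} [CommRing R]

open scoped Classical in
lemma dartSource_mulVec [Fintype G.Dart] (h : G.Dart → R) (v : V) :
    (G.dartSource R *ᵥ h) v = ∑ d, if d.fst = v then h d else 0 := by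
  simp [dartSource, mulVec, dotProduct]

open scoped Classical in
lemma dartEdge_mulVec [Fintype G.Dart] (h : G.Dart → R) (e : G.edgeSet) :
    (G.dartEdge R *ᵥ h) e = ∑ d, if d.edge = (e : Sym2 V) then h d else 0 := by
  simp [dartEdge, mulVec, dotProduct]

lemma dartEdge_mulVec_edge [Fintype G.Dart] (h : G.Dart → R) (d : G.Dart) :
    (G.dartEdge R *ᵥ h) ⟨d.edge, d.edge_mem⟩ = h d + h d.symm := by
  classical
  rw [dartEdge_mulVec, ← Finset.sum_filter, ← Finset.sum_pair d.symm_ne.symm]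
  refine Finset.sum_congr (Finset.ext fun d' => ?_) fun _ _ => rfl
  simp [dart_edge_eq_iff]

lemma exists_dart_edge (e : G.edgeSet) : ∃ d : G.Dart, e = ⟨d.edge, d.edge_mem⟩ := by
  obtain ⟨e, he⟩ := e
  induction e with
  | _ u v => exact ⟨⟨(u, v), he⟩, rfl⟩

lemma sum_dartSource_mulVec [Fintype V] [Fintype G.Dart] (h : G.Dart → R) (y : V → R) :
    ∑ v, (G.dartSource R *ᵥ h) v * y v = ∑ d, h d * y d.fst := by
  classical
  simp_rw [dartSource_mulVec, Finset.sum_mul]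
  rw [Finset.sum_comm]
  simp [ite_mul]

lemma sum_dartEdge_mulVec [Fintype G.Dart] [Fintype G.edgeSet] (h : G.Dart → R) (y : G.edgeSet → R) :
    ∑ e, (G.dartEdge R *ᵥ h) e * y e = ∑ d, h d * y ⟨d.edge, d.edge_mem⟩ := by
  classical
  simp_rw [dartEdge_mulVec, Finset.sum_mul]
  rw [Finset.sum_comm]
  refine Finset.sum_congr rfl fun d _ => ?_
  rw [Finset.sum_eq_single ⟨d.edge, d.edge_mem⟩]
  · simp
  · intro e _ he
    rw [if_neg, zero_mul]
    exact fun h => he (Subtype.ext h.symm)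
  · simp

lemma dartSource_dartEdge_span_eq_top [Fintype V] [Fintype G.Dart] [Fintype G.edgeSet]
    (hG : G.Connected) (v₀ : V) [DecidableEq V]
    [DecidableEq G.edgeSet] :
    LinearMap.range ((G.dartSource R).fromRows (G.dartEdge R)).mulVecLin ⊔
      Submodule.span R {Pi.single (Sum.inl v₀) 1} = ⊤ := by
  classical
  set W := LinearMap.range ((G.dartSource R).fromRows (G.dartEdge R)).mulVecLin ⊔
      Submodule.span R {Pi.single (Sum.inl v₀) 1} with hW
  have hd : ∀ d : G.Dart, (Pi.single (Sum.inl d.fst) 1 +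
      Pi.single (Sum.inr ⟨d.edge, d.edge_mem⟩) 1 : V ⊕ G.edgeSet → R) ∈ W := by
    intro d
    refine Submodule.mem_sup_left ⟨Pi.single d 1, ?_⟩
    funext i
    rcases i with v | e
    · simp [dartSource, Pi.single_apply, eq_comm]
    · simp [dartEdge, Pi.single_apply, Subtype.ext_iff, eq_comm]
  have hadj : ∀ u v, G.Adj u v → (Pi.single (Sum.inl u) 1 : V ⊕ G.edgeSet → R) ∈ W →
      (Pi.single (Sum.inl v) 1 : V ⊕ G.edgeSet → R) ∈ W := by
    intro u v huv hu
    have h1 := hd ⟨(u, v), huv⟩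
    have h2 := hd (⟨(u, v), huv⟩ : G.Dart).symm
    simp only [Dart.edge_symm] at h2
    have h3 := W.add_mem (W.sub_mem h2 h1) hu
    convert h3 using 1
    simp
  have hv : ∀ v, (Pi.single (Sum.inl v) 1 : V ⊕ G.edgeSet → R) ∈ W := by
    intro v
    obtain ⟨p⟩ := hG.preconnected v₀ v
    have h0 : (Pi.single (Sum.inl v₀) 1 : V ⊕ G.edgeSet → R) ∈ W :=
      Submodule.mem_sup_right (Submodule.mem_span_singleton_self _)
    clear_value W
    clear hW
    induction p with
    | nil => exact h0
    | cons h _ ih => exact ih (hadj _ _ h h0)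
  have he : ∀ e, (Pi.single (Sum.inr e) 1 : V ⊕ G.edgeSet → R) ∈ W := by
    intro e
    obtain ⟨d, rfl⟩ := exists_dart_edge e
    simpa using W.sub_mem (hd d) (hv d.fst)
  rw [eq_top_iff]
  intro x _
  rw [pi_eq_sum_univ' x]
  refine W.sum_mem fun i _ => W.smul_mem _ ?_
  rcases i with v | e
  · convert hv v using 1
  · convert he e using 1

lemma sum_fromRows_mulVec [Fintype V] [Fintype G.Dart] [Fintype G.edgeSet] (h : G.Dart → R) :
    ∑ v, ((G.dartSource R).fromRows (G.dartEdge R) *ᵥ h) (Sum.inl v) =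
      ∑ e, ((G.dartSource R).fromRows (G.dartEdge R) *ᵥ h) (Sum.inr e) := by
  have h1 := sum_dartSource_mulVec h 1
  have h2 := sum_dartEdge_mulVec h 1
  simp only [Pi.one_apply, mul_one] at h1 h2
  simp [fromRows_mulVec, h1, h2]

/-- Functions on the darts of a connected graph with prescribed sums over the darts leaving each
vertex and over the darts above each edge. -/
lemma exists_fromRows_mulVec_eq [Fintype V] [Fintype G.Dart] [Fintype G.edgeSet]
    (hG : G.Connected) (x : V ⊕ G.edgeSet → R)
    (hx : ∑ v, x (Sum.inl v) = ∑ e, x (Sum.inr e)) :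
    ∃ h, (G.dartSource R).fromRows (G.dartEdge R) *ᵥ h = x := by
  classical
  obtain ⟨v₀⟩ := hG.nonempty
  have hmem : x ∈ (⊤ : Submodule R (V ⊕ G.edgeSet → R)) := trivial
  rw [← dartSource_dartEdge_span_eq_top hG v₀, Submodule.mem_sup] at hmem
  obtain ⟨_, ⟨h, rfl⟩, _, hz, rfl⟩ := hmem
  obtain ⟨t, rfl⟩ := Submodule.mem_span_singleton.1 hz
  simp only [mulVecLin_apply, Pi.add_apply, Finset.sum_add_distrib, sum_fromRows_mulVec,
    add_right_inj, Pi.smul_apply, smul_eq_mul] at hx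
  have ht : t = 0 := by simpa [Pi.single_apply] using hx
  exact ⟨h, by simp [ht]⟩

lemma card_dart [Fintype V] [Fintype G.Dart] [Fintype G.edgeSet] :
    Fintype.card G.Dart = 2 * Fintype.card G.edgeSet := by
  classical
  have h := G.dart_card_eq_twice_card_edges
  rw [edgeFinset, Set.toFinset_card] at h
  convert h

lemma finrank_ker_dartSource [Fintype V] [Fintype G.Dart] [Fintype G.edgeSet]
    {k : Type*} [Field k] (hG : G.Connected) [Nontrivial V] :
    Module.finrank k (LinearMap.ker (G.dartSource k).mulVecLin) =
      2 * Fintype.card G.edgeSet - Fintype.card V := by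
  classical
  have hsurj : LinearMap.range (G.dartSource k).mulVecLin = ⊤ := by
    rw [eq_top_iff]
    intro x _
    choose w hw using fun v => hG.preconnected.exists_adj_of_nontrivial v
    rw [pi_eq_sum_univ' x]
    refine Submodule.sum_mem _ fun v _ => Submodule.smul_mem _ _
      ⟨Pi.single ⟨(v, w v), hw v⟩ 1, ?_⟩
    funext u
    simp [dartSource, Pi.single_apply, eq_comm]
  have h := LinearMap.finrank_range_add_finrank_ker (G.dartSource k).mulVecLin
  rw [hsurj, finrank_top, Module.finrank_fintype_fun_eq_card,
    Module.finrank_fintype_fun_eq_card] at h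
  have := card_dart (G := G)
  omega

lemma finrank_ker_fromRows [Fintype V] [Fintype G.Dart] [Fintype G.edgeSet]
    {k : Type*} [Field k] (hG : G.Connected) :
    Module.finrank k (LinearMap.ker ((G.dartSource k).fromRows (G.dartEdge k)).mulVecLin) =
      Fintype.card G.edgeSet + 1 - Fintype.card V := by
  classical
  let σ : (V ⊕ G.edgeSet → k) →ₗ[k] k :=
    ∑ v, LinearMap.proj (Sum.inl v) - ∑ e, LinearMap.proj (Sum.inr e)
  have hσ : ∀ x, σ x = ∑ v, x (Sum.inl v) - ∑ e, x (Sum.inr e) := fun x => by simp [σ]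
  have hr : LinearMap.range ((G.dartSource k).fromRows (G.dartEdge k)).mulVecLin =
      LinearMap.ker σ := by
    ext x
    rw [LinearMap.mem_ker, hσ, sub_eq_zero]
    refine ⟨?_, fun hx => exists_fromRows_mulVec_eq hG x hx⟩
    rintro ⟨h, rfl⟩
    exact sum_fromRows_mulVec h
  obtain ⟨v₀⟩ := hG.nonempty
  have hσr : LinearMap.range σ = ⊤ := by
    refine LinearMap.range_eq_top.2 fun t => ⟨Pi.single (Sum.inl v₀) t, ?_⟩
    simp [hσ, Pi.single_apply]
  have h1 := LinearMap.finrank_range_add_finrank_ker σ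
  have h := LinearMap.finrank_range_add_finrank_ker
    ((G.dartSource k).fromRows (G.dartEdge k)).mulVecLin
  rw [hr] at h
  rw [hσr, finrank_top, Module.finrank_self, Module.finrank_fintype_fun_eq_card,
    Fintype.card_sum] at h1
  rw [Module.finrank_fintype_fun_eq_card] at h
  have := card_dart (G := G)
  omega

end Incidence

end SimpleGraph

section Syzygies

open Matrix

/-- Variables outside a monomial can be cancelled against it modulo the ideal they generate. -/
lemma mem_span_X_image_of_mul_prod_X_mem {σ R : Type*} [CommRing R] {s : Finset σ} {T : Set σ}
    (hsT : ∀ i ∈ T, i ∉ s) {f : MvPolynomial σ R}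
    (hf : f * ∏ i ∈ s, X i ∈ Ideal.span (X '' T : Set (MvPolynomial σ R))) :
    f ∈ Ideal.span (X '' T : Set (MvPolynomial σ R)) := by
  classical
  rw [mem_ideal_span_X_image] at hf ⊢
  intro m hm
  have hprod : (∏ i ∈ s, X i : MvPolynomial σ R) = monomial (∑ i ∈ s, Finsupp.single i 1) 1 := by
    rw [monomial_sum_one]
    rfl
  obtain ⟨i, hi, hmi⟩ := hf (m + ∑ i ∈ s, Finsupp.single i 1) (by
    rw [mem_support_iff, hprod, coeff_mul_monomial, mul_one]
    exact mem_support_iff.1 hm)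
  refine ⟨i, hi, ?_⟩
  rwa [Finsupp.add_apply, Finsupp.finsetSum_apply, Finset.sum_eq_zero, add_zero] at hmi
  intro j hj
  exact Finsupp.single_eq_of_ne (by rintro rfl; exact hsT _ hi hj)

open scoped Classical in
/-- The product of the variables indexed by the complement of an edge. -/
noncomputable def edgeComplement (k : Type*) [Field k] {n : ℕ} (e : Sym2 (Fin n)) :
    MvPolynomial (Fin n) k :=
  ∏ i ∈ Finset.univ.filter (fun i : Fin n => i ∉ e), X i

variable {k : Type*} [Field k] {n : ℕ} {G : SimpleGraph (Fin n)}

lemma edgeComplement_mem {e : Sym2 (Fin n)} (he : ¬ e.IsDiag) :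
    edgeComplement k e ∈ weightedHomogeneousSubmodule k (fun _ => 1 : Fin n → ℕ) (n - 2) := by
  classical
  have hcard : (Finset.univ.filter (fun i : Fin n => i ∉ e)).card = n - 2 := by
    have h1 := Finset.card_filter_add_card_filter_not (s := Finset.univ) (fun i : Fin n => i ∈ e)
    have h2 : Finset.univ.filter (fun i : Fin n => i ∈ e) = e.toFinset := by
      ext i
      simp
    rw [h2, Sym2.card_toFinset_of_not_isDiag e he, Finset.card_univ, Fintype.card_fin] at h1
    omega
  have h := IsWeightedHomogeneous.prod (R := k) (w := (fun _ => 1 : Fin n → ℕ))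
    (Finset.univ.filter (fun i : Fin n => i ∉ e)) X (fun _ => 1)
    (fun i _ => isWeightedHomogeneous_X k _ i)
  rw [Finset.sum_const, hcard, smul_eq_mul, mul_one] at h
  rw [mem_weightedHomogeneousSubmodule]
  convert h
  unfold edgeComplement
  congr!

lemma X_mul_edgeComplement (d : G.Dart) :
    X d.snd * edgeComplement k d.edge = ∏ i ∈ Finset.univ.erase d.fst, X i := by
  classical
  have h : Finset.univ.erase d.fst =
      insert d.snd (Finset.univ.filter (fun i : Fin n => i ∉ d.edge)) := by
    ext i
    have := d.fst_ne_snd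
    simp only [Finset.mem_erase, Finset.mem_univ, and_true, Finset.mem_insert, Finset.mem_filter,
      true_and, SimpleGraph.Dart.edge, Sym2.mem_iff, Sym2.mk]
    grind
  rw [h, Finset.prod_insert]
  · unfold edgeComplement
    congr!
  · simp [SimpleGraph.Dart.edge]

variable [Fintype G.Dart]

lemma dartEdge_mulVec_eq_zero_iff {R : Type*} [CommRing R] (a : G.Dart → R) :
    G.dartEdge R *ᵥ a = 0 ↔ ∀ d, a d + a d.symm = 0 := by
  refine ⟨fun h d => ?_, fun h => funext fun e => ?_⟩
  · rw [← SimpleGraph.dartEdge_mulVec_edge, h, Pi.zero_apply]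
  · obtain ⟨d, rfl⟩ := SimpleGraph.exists_dart_edge e
    rw [SimpleGraph.dartEdge_mulVec_edge, h, Pi.zero_apply]

lemma exists_eq_X_mul_of_dartEdge_mulVec_eq_zero {h : G.Dart → MvPolynomial (Fin n) k}
    (hh : G.dartEdge _ *ᵥ (fun d => h d * X d.snd) = 0) :
    ∃ a : G.Dart → MvPolynomial (Fin n) k,
      h = (fun d => X d.fst * a d) ∧ G.dartEdge _ *ᵥ a = 0 := by
  rw [dartEdge_mulVec_eq_zero_iff] at hh
  have hdvd : ∀ d : G.Dart, X d.fst ∣ h d := by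
    intro d
    have h1 : X d.fst ∣ h d * X d.snd := by
      rw [eq_neg_of_add_eq_zero_left (hh d)]
      exact (Dvd.intro_left _ rfl).neg_right
    refine ((X_prime (R := k) (i := d.fst)).dvd_or_dvd h1).resolve_right fun h2 => ?_
    exact d.fst_ne_snd (X_dvd_X.1 h2)
  choose a ha using hdvd
  refine ⟨a, funext ha, (dartEdge_mulVec_eq_zero_iff a).2 fun d => ?_⟩
  have h1 := hh d
  rw [ha, ha d.symm] at h1
  have h2 : X d.fst * X d.snd * (a d + a d.symm) = 0 := by
    rw [← h1]
    change _ = _ + X d.snd * a d.symm * X d.fst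
    ring
  exact (mul_eq_zero.1 h2).resolve_left (mul_ne_zero (X_ne_zero _) (X_ne_zero _))

lemma dartEdge_mulVec_X_mul_X {a : G.Dart → MvPolynomial (Fin n) k}
    (ha : G.dartEdge _ *ᵥ a = 0) :
    G.dartEdge _ *ᵥ (fun d => X d.fst * a d * X d.snd) = 0 := by
  rw [dartEdge_mulVec_eq_zero_iff] at ha ⊢
  intro d
  change X d.fst * a d * X d.snd + X d.snd * a d.symm * X d.fst = 0
  linear_combination X d.fst * X d.snd * ha d

lemma dartSource_mulVec_X_mul (a : G.Dart → MvPolynomial (Fin n) k) :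
    G.dartSource _ *ᵥ (fun d => X d.fst * a d) = fun v => X v * (G.dartSource _ *ᵥ a) v := by
  classical
  funext v
  rw [SimpleGraph.dartSource_mulVec, SimpleGraph.dartSource_mulVec, Finset.mul_sum]
  refine Finset.sum_congr rfl fun d _ => ?_
  split_ifs with h
  · rw [h]
  · simp

variable [Fintype G.edgeSet]

lemma sum_dartEdge_mulVec_mul_edgeComplement (h : G.Dart → MvPolynomial (Fin n) k) :
    ∑ e, (G.dartEdge _ *ᵥ (fun d => h d * X d.snd)) e * edgeComplement k e.1 =
      ∑ v, (G.dartSource _ *ᵥ h) v * ∏ i ∈ Finset.univ.erase v, X i := by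
  rw [SimpleGraph.sum_dartEdge_mulVec, SimpleGraph.sum_dartSource_mulVec]
  refine Finset.sum_congr rfl fun d _ => ?_
  rw [mul_assoc, X_mul_edgeComplement]

lemma exists_dartEdge_mulVec_eq {f : G.edgeSet → MvPolynomial (Fin n) k}
    (hf : ∑ e, f e * edgeComplement k e.1 = 0) :
    ∃ h : G.Dart → MvPolynomial (Fin n) k, G.dartEdge _ *ᵥ (fun d => h d * X d.snd) = f := by
  classical
  have hmem : ∀ d : G.Dart, f ⟨d.edge, d.edge_mem⟩ ∈
      Ideal.span (X '' {d.fst, d.snd} : Set (MvPolynomial (Fin n) k)) := by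
    intro d
    have hnot : ∀ i ∈ ({d.fst, d.snd} : Set (Fin n)),
        i ∉ Finset.univ.filter (fun i : Fin n => i ∉ d.edge) := by
      rintro i (rfl | rfl) <;> simp [SimpleGraph.Dart.edge]
    refine mem_span_X_image_of_mul_prod_X_mem hnot ?_
    rw [← Finset.add_sum_erase _ _ (Finset.mem_univ ⟨d.edge, d.edge_mem⟩)] at hf
    have hf' := eq_neg_of_add_eq_zero_left hf
    convert_to f ⟨d.edge, d.edge_mem⟩ * edgeComplement k d.edge ∈ _
    · unfold edgeComplement
      congr!
    rw [hf']
    refine Submodule.neg_mem _ (Ideal.sum_mem _ fun e he => Ideal.mul_mem_left _ _ ?_)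
    have hne : e.1 ≠ d.edge := fun h => (Finset.mem_erase.1 he).1 (Subtype.ext h)
    obtain ⟨i, hi, hie⟩ : ∃ i ∈ ({d.fst, d.snd} : Set (Fin n)), i ∉ e.1 := by
      by_contra! hcon
      exact hne ((Sym2.mem_and_mem_iff d.fst_ne_snd).1
        ⟨hcon d.fst (by simp), hcon d.snd (by simp)⟩)
    exact Ideal.mem_of_dvd _ (Finset.dvd_prod_of_mem _ (by simpa using hie))
      (Ideal.subset_span ⟨i, hi, rfl⟩)
  let L : (G.Dart → MvPolynomial (Fin n) k) →ₗ[MvPolynomial (Fin n) k] _ :=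
    (G.dartEdge (MvPolynomial (Fin n) k)).mulVecLin ∘ₗ
      LinearMap.pi fun d => (X d.snd : MvPolynomial (Fin n) k) • LinearMap.proj d
  have hL : ∀ h, L h = G.dartEdge _ *ᵥ (fun d => h d * X d.snd) := by
    intro h
    simp only [L, LinearMap.comp_apply, mulVecLin_apply]
    congr 1
    funext d
    simp [mul_comm]
  have hsingle : ∀ (d : G.Dart) c, Pi.single ⟨d.edge, d.edge_mem⟩ (c * X d.snd) ∈
      LinearMap.range L := by
    intro d c
    refine ⟨Pi.single d c, ?_⟩
    rw [hL]
    funext e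
    rw [SimpleGraph.dartEdge_mulVec, Finset.sum_eq_single d]
    · simp [Pi.single_apply, Subtype.ext_iff, eq_comm]
    · intro d' _ hd'
      simp [Pi.single_eq_of_ne hd']
    · simp
  obtain ⟨h, hh⟩ : f ∈ LinearMap.range L := by
    rw [← Finset.univ_sum_single f]
    refine Submodule.sum_mem _ fun e _ => ?_
    obtain ⟨d, rfl⟩ := SimpleGraph.exists_dart_edge e
    have h1 := hmem d
    rw [Set.image_pair, Ideal.mem_span_pair] at h1
    obtain ⟨a, b, hab⟩ := h1
    rw [← hab, Pi.single_add]
    refine Submodule.add_mem _ ?_ (hsingle d b)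
    have h2 := hsingle d.symm a
    simp only [SimpleGraph.Dart.edge_symm] at h2
    exact h2
  exact ⟨h, by rw [← hL, hh]⟩

lemma exists_dartSource_eq_zero_dartEdge_eq (hG : G.Connected)
    {f : G.edgeSet → MvPolynomial (Fin n) k} (hf : ∑ e, f e * edgeComplement k e.1 = 0) :
    ∃ h : G.Dart → MvPolynomial (Fin n) k,
      G.dartSource _ *ᵥ h = 0 ∧ G.dartEdge _ *ᵥ (fun d => h d * X d.snd) = f := by
  classical
  obtain ⟨h, rfl⟩ := exists_dartEdge_mulVec_eq hf
  rw [sum_dartEdge_mulVec_mul_edgeComplement] at hf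
  have hdvd : ∀ v, X v ∣ (G.dartSource (MvPolynomial (Fin n) k) *ᵥ h) v := by
    intro v
    rw [← Finset.add_sum_erase _ _ (Finset.mem_univ v)] at hf
    have h1 : X v ∣ (G.dartSource (MvPolynomial (Fin n) k) *ᵥ h) v *
        ∏ i ∈ Finset.univ.erase v, X i := by
      rw [eq_neg_of_add_eq_zero_left hf]
      refine (Finset.dvd_sum fun u hu => Dvd.dvd.mul_left (Finset.dvd_prod_of_mem _ ?_) _).neg_right
      simpa using (Finset.ne_of_mem_erase hu).symm
    refine ((X_prime (R := k) (i := v)).dvd_or_dvd h1).resolve_right fun h2 => ?_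
    obtain ⟨i, hi, hvi⟩ := ((X_prime (R := k) (i := v)).dvd_finsetProd_iff _).1 h2
    exact (Finset.mem_erase.1 hi).1 (X_dvd_X.1 hvi).symm
  choose t ht using hdvd
  have hsum : ∑ v, t v = 0 := by
    have h1 : (∑ v, t v) * ∏ i, X i = 0 := by
      rw [← hf, Finset.sum_mul]
      refine Finset.sum_congr rfl fun v _ => ?_
      rw [ht, ← Finset.mul_prod_erase _ _ (Finset.mem_univ v)]
      ring
    exact (mul_eq_zero.1 h1).resolve_right (Finset.prod_ne_zero_iff.2 fun i _ => X_ne_zero i)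
  obtain ⟨a, ha⟩ := SimpleGraph.exists_fromRows_mulVec_eq hG (Sum.elim t 0) (by simpa using hsum)
  have hat : G.dartSource _ *ᵥ a = t := by
    funext v
    simpa [fromRows_mulVec] using congrFun ha (Sum.inl v)
  have ha0 : G.dartEdge _ *ᵥ a = 0 := by
    funext e
    simpa [fromRows_mulVec] using congrFun ha (Sum.inr e)
  have h1 : (fun d : G.Dart => (h d - X d.fst * a d) * X d.snd) =
      (fun d => h d * X d.snd) - fun d : G.Dart => X d.fst * a d * X d.snd :=
    funext fun d => sub_mul _ _ _
  have h2 : (fun d : G.Dart => h d - X d.fst * a d) = h - fun d : G.Dart => X d.fst * a d := rfl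
  refine ⟨fun d => h d - X d.fst * a d, ?_, ?_⟩
  · rw [h2, mulVec_sub, dartSource_mulVec_X_mul, hat]
    funext v
    simp [ht]
  · rw [h1, mulVec_sub, dartEdge_mulVec_X_mul_X ha0, sub_zero]

end Syzygies
section LinearResolution

open Matrix

/-- The kernel of a matrix over a field, parametrized after an extension of scalars. -/
lemma Matrix.exists_kernel_parametrization {k R m d : Type*} [Field k] [CommRing R] [Fintype m]
    [Fintype d] (f : k →+* R) (N : Matrix m d k) {b : ℕ}
    (hb : Module.finrank k (LinearMap.ker N.mulVecLin) = b) :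
    ∃ (z : Matrix d (Fin b) k) (q : Matrix (Fin b) d k),
      (∀ c : Fin b → R, N.map f *ᵥ (z.map f *ᵥ c) = 0) ∧
      (∀ c : Fin b → R, q.map f *ᵥ (z.map f *ᵥ c) = c) ∧
      ∀ a : d → R, N.map f *ᵥ a = 0 → z.map f *ᵥ (q.map f *ᵥ a) = a := by
  classical
  obtain ⟨z, q, s, h1, h2, h3⟩ := N.exists_kernel_matrices hb
  refine ⟨z, q, fun c => ?_, fun c => ?_, fun a ha => ?_⟩
  · rw [mulVec_mulVec, ← Matrix.map_mul, h1]
    simp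
  · rw [mulVec_mulVec, ← Matrix.map_mul, h2]
    simp
  · have h4 := congrArg (fun M : Matrix d d k => M.map f *ᵥ a) h3
    simpa [Matrix.map_add, Matrix.map_mul, add_mulVec, ← mulVec_mulVec, ha] using h4

lemma SimpleGraph.dartSource_map {V k R : Type*} {G : SimpleGraph V} [CommRing k] [CommRing R]
    (f : k →+* R) : (G.dartSource k).map f = G.dartSource R := by
  ext v d
  simp only [dartSource, map_apply, of_apply]
  split_ifs <;> simp

lemma SimpleGraph.dartEdge_map {V k R : Type*} {G : SimpleGraph V} [CommRing k] [CommRing R]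
    (f : k →+* R) : (G.dartEdge k).map f = G.dartEdge R := by
  ext v d
  simp only [dartEdge, map_apply, of_apply]
  split_ifs <;> simp

lemma sum_smul_mulVec_mul {R ι m d : Type*} [CommRing R] [Fintype ι] [Fintype d]
    (M : Matrix m d R) (z : Matrix d ι R) (u : d → R) (c : ι → R) :
    ∑ j, c j • (M *ᵥ fun i => z i j * u i) = M *ᵥ fun i => (z *ᵥ c) i * u i := by
  simp_rw [← mulVec_smul]
  rw [← mulVec_sum]
  congr 1
  funext i
  simp only [Finset.sum_apply, Pi.smul_apply, smul_eq_mul, mulVec, dotProduct, Finset.sum_mul]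
  exact Finset.sum_congr rfl fun j _ => by ring

variable {k : Type*} [Field k] {n : ℕ}

lemma mulVec_C_mul_X_mem {m d : Type*} [Fintype d] {M : Matrix m d (MvPolynomial (Fin n) k)}
    (hM : ∀ i j, M i j ∈ Set.range C) (z : d → k) (u : d → Fin n) (i : m) :
    (M *ᵥ fun j => C (z j) * X (u j)) i ∈
      weightedHomogeneousSubmodule k (fun _ => 1 : Fin n → ℕ) 1 := by
  refine Submodule.sum_mem _ fun j _ => ?_
  obtain ⟨t, ht⟩ := hM i j
  change M i j * (C (z j) * X (u j)) ∈ _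
  rw [← ht, ← mul_assoc, ← C_mul, ← smul_eq_C_mul]
  exact Submodule.smul_mem _ _ (isWeightedHomogeneous_X k _ _)

/-- The linear syzygies of the edge complement monomials of a connected graph. -/
lemma exists_edgeComplement_resolution {G : SimpleGraph (Fin n)} [Fintype G.edgeSet]
    [Nontrivial (Fin n)] (hG : G.Connected) :
    ∃ (g₁ : Fin (2 * Fintype.card G.edgeSet - n) → G.edgeSet → MvPolynomial (Fin n) k)
      (g₂ : Fin (Fintype.card G.edgeSet + 1 - n) → Fin (2 * Fintype.card G.edgeSet - n) →
        MvPolynomial (Fin n) k),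
      (∀ j s, g₁ j s ∈ weightedHomogeneousSubmodule k (fun _ => 1 : Fin n → ℕ) 1) ∧
      (∀ j s, g₂ j s ∈ weightedHomogeneousSubmodule k (fun _ => 1 : Fin n → ℕ) 1) ∧
      (∀ x : G.edgeSet → MvPolynomial (Fin n) k, ∑ e, x e * edgeComplement k e.1 = 0 ↔
        ∃ c : Fin _ → MvPolynomial (Fin n) k, x = ∑ j, c j • g₁ j) ∧
      (∀ x : Fin _ → MvPolynomial (Fin n) k, ∑ j, x j • g₁ j = 0 ↔
        ∃ c : Fin _ → MvPolynomial (Fin n) k, x = ∑ j, c j • g₂ j) ∧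
      ∀ x : Fin _ → MvPolynomial (Fin n) k, ∑ j, x j • g₂ j = 0 → x = 0 := by
  classical
  let : Fintype G.Dart := Fintype.ofFinite _
  have hw := SimpleGraph.finrank_ker_dartSource (k := k) hG
  have hz := SimpleGraph.finrank_ker_fromRows (k := k) hG
  rw [Fintype.card_fin] at hw hz
  obtain ⟨w, q, hw, hqw, hwq⟩ := (G.dartSource k).exists_kernel_parametrization
    (C : k →+* MvPolynomial (Fin n) k) hw
  obtain ⟨z, p, hz, hpz, hzp⟩ :=
    ((G.dartSource k).fromRows (G.dartEdge k)).exists_kernel_parametrization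
      (C : k →+* MvPolynomial (Fin n) k) hz
  have hmap : ((G.dartSource k).fromRows (G.dartEdge k)).map
      (C : k →+* MvPolynomial (Fin n) k) =
      (G.dartSource (MvPolynomial (Fin n) k)).fromRows (G.dartEdge _) := by
    rw [← SimpleGraph.dartSource_map (C : k →+* MvPolynomial (Fin n) k),
      ← SimpleGraph.dartEdge_map (C : k →+* MvPolynomial (Fin n) k)]
    ext (i | i) j <;> rfl
  rw [hmap] at hz hzp
  rw [SimpleGraph.dartSource_map] at hw hwq
  have hz1 : ∀ c, G.dartSource _ *ᵥ (z.map C *ᵥ c) = 0 := fun c => by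
    funext v
    simpa [fromRows_mulVec] using congrFun (hz c) (Sum.inl v)
  have hz2 : ∀ c, G.dartEdge _ *ᵥ (z.map C *ᵥ c) = 0 := fun c => by
    funext e
    simpa [fromRows_mulVec] using congrFun (hz c) (Sum.inr e)
  have h₁ := sum_smul_mulVec_mul (G.dartEdge (MvPolynomial (Fin n) k)) (w.map C)
    (fun d => X d.snd)
  have h₂ := sum_smul_mulVec_mul (q.map (C : k →+* MvPolynomial (Fin n) k)) (z.map C)
    (fun d => X d.fst)
  have hz3 : ∀ c, w.map C *ᵥ (q.map C *ᵥ fun d => (z.map C *ᵥ c) d * X d.fst) =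
      fun d => X d.fst * (z.map C *ᵥ c) d := fun c => by
    have h3 : (fun d : G.Dart => (z.map C *ᵥ c) d * X d.fst) =
        fun d : G.Dart => X d.fst * (z.map C *ᵥ c) d := funext fun d => mul_comm _ _
    rw [h3]
    refine hwq _ ?_
    rw [dartSource_mulVec_X_mul, hz1]
    exact funext fun v => mul_zero _
  refine ⟨fun j => G.dartEdge _ *ᵥ fun d => w.map C d j * X d.snd,
    fun j => q.map C *ᵥ fun d => z.map C d j * X d.fst,
    fun j s => mulVec_C_mul_X_mem (fun e d => ?_) (fun d => w d j) (fun d => d.snd) s,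
    fun j s => mulVec_C_mul_X_mem (fun i d => ⟨_, rfl⟩) (fun d => z d j) (fun d => d.fst) s,
    fun x => ?_, fun x => ?_, fun x hx => ?_⟩
  · rw [← SimpleGraph.dartEdge_map (C : k →+* MvPolynomial (Fin n) k)]
    exact ⟨_, rfl⟩
  · simp_rw [h₁]
    refine ⟨fun hx => ?_, ?_⟩
    · obtain ⟨h, hh, rfl⟩ := exists_dartSource_eq_zero_dartEdge_eq hG hx
      exact ⟨q.map C *ᵥ h, by rw [hwq h hh]⟩
    · rintro ⟨c, rfl⟩
      rw [sum_dartEdge_mulVec_mul_edgeComplement, hw]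
      simp
  · simp_rw [h₁, h₂]
    refine ⟨fun hx => ?_, ?_⟩
    · obtain ⟨a, ha, hB⟩ := exists_eq_X_mul_of_dartEdge_mulVec_eq_zero hx
      have hA : G.dartSource _ *ᵥ a = 0 := by
        have h3 := hw x
        rw [ha, dartSource_mulVec_X_mul] at h3
        funext v
        exact (mul_eq_zero.1 (congrFun h3 v)).resolve_left (X_ne_zero v)
      have hN := hzp a (by rw [fromRows_mulVec, hA, hB]; funext i; cases i <;> rfl)
      refine ⟨p.map C *ᵥ a, ?_⟩
      rw [hN, ← hqw x, ha]
      simp_rw [mul_comm]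
    · rintro ⟨c, rfl⟩
      rw [hz3]
      exact dartEdge_mulVec_X_mul_X (hz2 c)
  · have h3 := hz3 x
    rw [← h₂, hx, mulVec_zero] at h3
    have h6 : z.map C *ᵥ x = 0 := by
      funext d
      exact (mul_eq_zero.1 (congrFun h3 d).symm).resolve_left (X_ne_zero _)
    rw [← hpz x, h6, mulVec_zero]

end LinearResolution
section MinimalResolution

variable {R : Type*} [CommRing R]

lemma map_apply_eq_zero_of_map_single_eq_zero {ι κ : Type*} {S : Type*} [CommRing S] (χ : R →+* S)
    {d : (ι →₀ R) →ₗ[R] (κ →₀ R)} (hd : ∀ p q, χ (d (Finsupp.single p 1) q) = 0)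
    (f : ι →₀ R) (q : κ) : χ (d f q) = 0 := by
  induction f using Finsupp.induction_linear with
  | zero => simp
  | add f g hf hg => simp [hf, hg]
  | single p a =>
    rw [← mul_one a, ← smul_eq_mul, ← Finsupp.smul_single, map_smul, Finsupp.smul_apply,
      smul_eq_mul, map_mul, hd, mul_zero]

lemma isEmpty_of_range_eq_top {ι κ : Type*} {S : Type*} [CommRing S] [Nontrivial S] (χ : R →+* S)
    {d : (ι →₀ R) →ₗ[R] (κ →₀ R)} (hd : ∀ p q, χ (d (Finsupp.single p 1) q) = 0)
    (h : LinearMap.range d = ⊤) : IsEmpty κ := by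
  refine ⟨fun q => ?_⟩
  obtain ⟨f, hf⟩ := LinearMap.range_eq_top.1 h (Finsupp.single q 1)
  have h1 := map_apply_eq_zero_of_map_single_eq_zero χ hd f q
  rw [hf] at h1
  simp at h1

/-- A minimal resolution ends at the first vanishing differential. -/
lemma isEmpty_of_ker_eq_top {S : Type*} [CommRing S] [Nontrivial S] (χ : R →+* S)
    {ι : ℕ → Type*} {d : ∀ i, (ι (i + 1) →₀ R) →ₗ[R] (ι i →₀ R)}
    (hd : ∀ i p q, χ (d i (Finsupp.single p 1) q) = 0)
    (hex : ∀ i, LinearMap.ker (d i) = LinearMap.range (d (i + 1))) {m : ℕ}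
    (hm : LinearMap.ker (d m) = ⊤) (i : ℕ) (hi : m < i) : IsEmpty (ι i) := by
  induction i, hi using Nat.le_induction with
  | base => exact isEmpty_of_range_eq_top χ (hd (m + 1)) (by rw [← hex, hm])
  | succ i _ ih =>
    refine isEmpty_of_range_eq_top χ (hd (i + 1)) ?_
    rw [← hex]
    exact LinearMap.ker_eq_top.2 (Subsingleton.elim _ _)

end MinimalResolution

open scoped Classical in
/-- Let `G` be a connected graph on `n` vertices with `r` edges and let
`J ⊆ k[X_1,…,X_n]` be the squarefree monomial ideal generated by the degree
`n - 2` monomials `∏_{i ∉ e} X_i` for edges `e` of `G`.  Then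
`β_{0,n-2}(J) = r`, `β_{1,n-1}(J) = 2r - n`, `β_{2,n}(J) = r - n + 1`, and all
other graded Betti numbers of `J` vanish. -/
theorem betti_numbers_edge_complement_ideal
    {k : Type*} [Field k] (n : ℕ) (G : SimpleGraph (Fin n)) (hG : G.Connected)
    (r : ℕ) (hr : G.edgeSet.ncard = r)
    (J : Ideal (MvPolynomial (Fin n) k))
    (hJ : J = Ideal.span {f | ∃ e ∈ G.edgeSet,
        f = ∏ i ∈ Finset.univ.filter (fun i : Fin n => i ∉ e), X i})
    (β : ℕ → ℕ → ℕ)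
    (hβ : IsMinimalGradedFreeResolution k n (fun _ => 1) β ↥J
      (fun dg => {f : ↥J | (f : MvPolynomial (Fin n) k) ∈
        weightedHomogeneousSubmodule k (fun _ => 1) dg})) :
    β 0 (n - 2) = r ∧ β 1 (n - 1) = 2 * r - n ∧ β 2 n = r + 1 - n ∧
      ∀ i j, β i j ≠ 0 →
        (i = 0 ∧ j = n - 2) ∨ (i = 1 ∧ j = n - 1) ∨ (i = 2 ∧ j = n) := by
  classical
  obtain ⟨d, ε, hε, hε0, hex, hd, hdeg, hεdeg⟩ := hβ
  have hχ := fun i => map_apply_eq_zero_of_map_single_eq_zero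
    (constantCoeff (σ := Fin n) (R := k)) (hd i)
  have hβ0 : ∀ i, IsEmpty ((j : ℕ) × Fin (β i j)) → ∀ j, β i j = 0 := fun i hi j => by
    by_contra h
    exact hi.false ⟨j, ⟨0, Nat.pos_of_ne_zero h⟩⟩
  have hvanish := fun m => isEmpty_of_ker_eq_top (constantCoeff (σ := Fin n) (R := k))
    (ι := fun i => (j : ℕ) × Fin (β i j)) (d := d) hd hex (m := m)
  let : Fintype G.edgeSet := Fintype.ofFinite _
  have hcard : Fintype.card G.edgeSet = r := by
    rw [← hr, ← Nat.card_coe_set_eq, Nat.card_eq_fintype_card]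
  obtain ⟨v₀⟩ := hG.nonempty
  rcases subsingleton_or_nontrivial (Fin n) with hn | hn
  · have hn1 : n = 1 := by
      have h1 := Fintype.card_le_one_iff_subsingleton.2 hn
      have h2 := Fintype.card_pos_iff.2 ⟨v₀⟩
      rw [Fintype.card_fin] at h1 h2
      omega
    have hE : IsEmpty G.edgeSet := ⟨fun e => by
      obtain ⟨a, -⟩ := SimpleGraph.exists_dart_edge e
      exact a.fst_ne_snd (Subsingleton.elim _ _)⟩
    have hr0 : r = 0 := by rw [← hcard, Fintype.card_eq_zero]
    have hJ0 : J = ⊥ := by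
      rw [hJ, Ideal.span_eq_bot]
      rintro _ ⟨e, he, -⟩
      exact (hE.false ⟨e, he⟩).elim
    have hempty : ∀ i, IsEmpty ((j : ℕ) × Fin (β i j)) := by
      have h0 : IsEmpty ((j : ℕ) × Fin (β 0 j)) := by
        refine isEmpty_of_range_eq_top constantCoeff (d := d 0) (hd 0) ?_
        rw [← hε0, LinearMap.ker_eq_top]
        exact LinearMap.ext fun f => Subtype.ext ((Submodule.mem_bot _).1 (hJ0.le (ε f).2))
      intro i
      rcases Nat.eq_zero_or_pos i with rfl | hi
      · exact h0
      · exact hvanish 0 (LinearMap.ker_eq_top.2 (Subsingleton.elim _ _)) i hi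
    have hz := fun i => hβ0 i (hempty i)
    simp only [hz]
    subst hn1 hr0
    simp
  · have hn2 : 2 ≤ n := by
      have := Fintype.one_lt_card_iff_nontrivial.2 hn
      rwa [Fintype.card_fin] at this
    obtain ⟨g₁, g₂, hg₁, hg₂, hsyz₁, hsyz₂, hsyz₃⟩ := exists_edgeComplement_resolution (k := k) hG
    have hJ' : J = Ideal.span (Set.range fun e : G.edgeSet => edgeComplement k e.1) := by
      rw [hJ]
      congr 1
      ext f
      simp only [Set.mem_ofPred_eq, Set.mem_range, Subtype.exists, exists_prop, edgeComplement]
      refine exists_congr fun e => and_congr_right fun _ => ?_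
      rw [eq_comm]
    have hmin : ∀ {ι τ : Type} [Fintype ι] (g : ι → τ → MvPolynomial (Fin n) k)
        (_ : ∀ j s, g j s ∈ weightedHomogeneousSubmodule k (fun _ => 1 : Fin n → ℕ) 1)
        (c : ι → MvPolynomial (Fin n) k) (s : τ), constantCoeff ((∑ j, c j • g j) s) = 0 := by
      intro ι τ _ g hg c s
      rw [Finset.sum_apply, map_sum]
      refine Finset.sum_eq_zero fun j _ => ?_
      rw [Pi.smul_apply, smul_eq_mul, map_mul,
        constantCoeff_eq_zero_of_isWeightedHomogeneous one_ne_zero (hg j s), mul_zero]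
    obtain ⟨hβ₀, hb₀, φ₀, hφ₀, hφ₀deg⟩ := minimalCover_equiv (D := 0) (e := n - 2)
      (LinearMap.pi fun _ : Unit => J.subtype ∘ₗ ε)
      (fun (e : G.edgeSet) _ => edgeComplement k e.1)
      (fun x => by
        have h1 : x () ∈ J ↔ ∃ c : G.edgeSet → MvPolynomial (Fin n) k,
            ∑ e, c e * edgeComplement k e.1 = x () := by
          rw [hJ']
          exact Ideal.mem_span_range_iff_exists_fun
        constructor
        · rintro ⟨f, rfl⟩
          obtain ⟨c, hc⟩ := h1.1 (ε f).2
          refine ⟨c, funext fun s => ?_⟩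
          rw [← hc]
          simp
        · rintro ⟨c, hc⟩
          obtain ⟨f, hf⟩ := hε ⟨x (), h1.2 ⟨c, by simp [hc]⟩⟩
          exact ⟨f, funext fun s => congrArg Subtype.val hf⟩)
      (fun c hc j => by
        obtain ⟨y, rfl⟩ := (hsyz₁ c).1 (by simpa using congrFun hc ())
        exact hmin g₁ hg₁ y j)
      (fun f hf p => by
        have h1 : f ∈ LinearMap.ker ε := Subtype.ext (congrFun hf ())
        rw [hε0] at h1
        obtain ⟨f, rfl⟩ := h1
        exact hχ 0 f p)
      (fun dg f hf s => ⟨hεdeg dg f hf, fun h => absurd h (Nat.not_lt_zero _)⟩)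
      (fun e _ => edgeComplement_mem (G.not_isDiag_of_mem_edgeSet e.2))
    have hε' : ∀ f, ε f = 0 ↔ ∑ e, φ₀ f e * edgeComplement k e.1 = 0 := fun f => by
      have h1 := congrFun (hφ₀ f) ()
      simp only [Finset.sum_apply, Pi.smul_apply, smul_eq_mul] at h1
      rw [← h1]
      exact Subtype.ext_iff
    have hd0 : ∀ x, (∃ f, φ₀ (d 0 f) = x) ↔ ∑ e, x e * edgeComplement k e.1 = 0 := fun x => by
      have h1 := hε' (φ₀.symm x)
      rw [LinearEquiv.apply_symm_apply, ← LinearMap.mem_ker, hε0] at h1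
      rw [← h1, LinearMap.mem_range]
      simp_rw [LinearEquiv.eq_symm_apply]
    obtain ⟨hβ₁, hb₁, φ₁, hφ₁, hφ₁deg⟩ := minimalCover_equiv (D := 0 + (n - 2)) (e := 1)
      (φ₀.toLinearMap ∘ₗ d 0) g₁ (fun x => (hd0 x).trans (hsyz₁ x))
      (fun c hc j => by
        obtain ⟨y, rfl⟩ := (hsyz₂ c).1 hc
        exact hmin g₂ hg₂ y j)
      (fun f hf p => by
        have h1 : f ∈ LinearMap.ker (d 0) := φ₀.map_eq_zero_iff.1 hf
        rw [hex] at h1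
        obtain ⟨f, rfl⟩ := h1
        exact hχ 1 f p)
      (fun dg f hf => hφ₀deg dg _ (hdeg 0 dg f hf)) hg₁
    have hd1 : ∀ x, (∃ f, φ₁ (d 1 f) = x) ↔ ∑ j, x j • g₁ j = 0 := fun x => by
      have h1 := hφ₁ (φ₁.symm x)
      rw [LinearEquiv.apply_symm_apply] at h1
      have h2 : φ₁.symm x ∈ LinearMap.range (d 1) ↔ ∑ j, x j • g₁ j = 0 := by
        rw [← hex, LinearMap.mem_ker, ← h1]
        exact φ₀.map_eq_zero_iff.symm
      rw [← h2, LinearMap.mem_range]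
      simp_rw [LinearEquiv.eq_symm_apply]
    obtain ⟨hβ₂, hb₂, φ₂, hφ₂, -⟩ := minimalCover_equiv (D := 0 + (n - 2) + 1) (e := 1)
      (φ₁.toLinearMap ∘ₗ d 1) g₂ (fun x => (hd1 x).trans (hsyz₂ x))
      (fun c hc j => by simp [hsyz₃ c hc])
      (fun f hf p => by
        have h1 : f ∈ LinearMap.ker (d 1) := φ₁.map_eq_zero_iff.1 hf
        rw [hex] at h1
        obtain ⟨f, rfl⟩ := h1
        exact hχ 2 f p)
      (fun dg f hf => hφ₁deg dg _ (hdeg 1 dg f hf)) hg₂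
    have hd2 : LinearMap.ker (d 2) = ⊤ := by
      rw [LinearMap.ker_eq_top, ← LinearMap.range_eq_bot, ← hex, LinearMap.ker_eq_bot']
      intro f hf
      have h1 := hφ₂ f
      rw [LinearMap.comp_apply, hf, map_zero] at h1
      exact φ₂.map_eq_zero_iff.1 (hsyz₃ _ h1.symm)
    have hlast := hvanish 2 hd2
    have e0 : 0 + (n - 2) = n - 2 := by omega
    have e1 : n - 2 + 1 = n - 1 := by omega
    have e2 : n - 1 + 1 = n := by omega
    rw [e0] at hβ₀ hb₀ hβ₁ hb₁ hβ₂ hb₂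
    rw [e1] at hβ₁ hb₁ hβ₂ hb₂
    rw [e2] at hβ₂ hb₂
    rw [Fintype.card_fin, hcard] at hb₁ hb₂
    rw [hcard] at hb₀
    refine ⟨hb₀, hb₁, hb₂, fun i j hij => ?_⟩
    match i with
    | 0 => exact Or.inl ⟨rfl, hβ₀ j hij⟩
    | 1 => exact Or.inr (Or.inl ⟨rfl, hβ₁ j hij⟩)
    | 2 => exact Or.inr (Or.inr ⟨rfl, hβ₂ j hij⟩)
    | i + 3 => exact absurd (hβ0 _ (hlast _ (by omega)) j) hij
end

section
/- For the cover ideal J(K_n) of the complete graph on n vertices and any s ≥ 1, the i-th total Betti number of J(K_n)^s is β_i(J(K_n)^s) = C(n-1,i) · C(n-1-i+s, n-1). -/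
open MvPolynomial

/-- `b : ℕ → ℕ` is the sequence of ranks of a minimal free resolution of the
module `M` over the polynomial ring `S = k[X_1,…,X_n]`; by minimality the `b i`
are the total Betti numbers `β_i(M) = dim_k Tor_i^S(M,k)`.  Minimality is
expressed by requiring that all matrix entries of the differentials lie in the
maximal ideal `(X_1,…,X_n)`, i.e. have zero constant coefficient. -/
def IsMinimalFreeResolution (k : Type*) [Field k] (n : ℕ) (b : ℕ → ℕ)
    (M : Type*) [AddCommGroup M] [Module (MvPolynomial (Fin n) k) M] : Prop :=
  ∃ (d : (i : ℕ) → (Fin (b (i + 1)) →₀ MvPolynomial (Fin n) k) →ₗ[MvPolynomial (Fin n) k]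
        (Fin (b i) →₀ MvPolynomial (Fin n) k))
    (ε : (Fin (b 0) →₀ MvPolynomial (Fin n) k) →ₗ[MvPolynomial (Fin n) k] M),
    Function.Surjective ε ∧
    LinearMap.ker ε = LinearMap.range (d 0) ∧
    (∀ i, LinearMap.ker (d i) = LinearMap.range (d (i + 1))) ∧
    (∀ i p q, constantCoeff (d i (Finsupp.single p 1) q) = 0)

section ExtLength

open CategoryTheory Abelian

universe u

variable {R : Type u} [CommRing R] (K : Type u) [AddCommGroup K] [Module R K]
  {A B C : Type u} [AddCommGroup A] [AddCommGroup B] [AddCommGroup C]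
  [Module R A] [Module R B] [Module R C]

/-- The length of `Ext^i(M, K)` over `R`. -/
noncomputable def extLength (R : Type u) [CommRing R] (K : Type u) [AddCommGroup K] [Module R K]
    (M : Type u) [AddCommGroup M] [Module R M] (i : ℕ) : ℕ∞ :=
  Module.length R (Ext (ModuleCat.of R M) (ModuleCat.of R K) i)

/-- The map `Ext^i(B, K) → Ext^i(A, K)` induced by a linear map `A → B`. -/
noncomputable def extPrecomp (f : A →ₗ[R] B) (i : ℕ) :
    Ext (ModuleCat.of R B) (ModuleCat.of R K) i →ₗ[R]
      Ext (ModuleCat.of R A) (ModuleCat.of R K) i :=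
  (Ext.mk₀ (ModuleCat.ofHom f)).precompOfLinear R (ModuleCat.of R K) (zero_add i)

lemma extPrecomp_apply (f : A →ₗ[R] B) (i : ℕ)
    (x : Ext (ModuleCat.of R B) (ModuleCat.of R K) i) :
    extPrecomp K f i x = (Ext.mk₀ (ModuleCat.ofHom f)).comp x (zero_add i) := rfl

lemma extPrecomp_comp (f : A →ₗ[R] B) (g : B →ₗ[R] C) (i : ℕ) :
    extPrecomp K (g ∘ₗ f) i = extPrecomp K f i ∘ₗ extPrecomp K g i := by
  ext x
  simp [extPrecomp_apply, ModuleCat.ofHom_comp]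

lemma extPrecomp_id (i : ℕ) :
    extPrecomp K (LinearMap.id : A →ₗ[R] A) i = LinearMap.id := by
  ext x
  simp [extPrecomp_apply]

lemma extPrecomp_add (f g : A →ₗ[R] B) (i : ℕ) :
    extPrecomp K (f + g) i = extPrecomp K f i + extPrecomp K g i := by
  ext x
  simp [extPrecomp_apply, ModuleCat.ofHom_add, Ext.mk₀_add]

lemma extPrecomp_smul_eq_zero (f : A →ₗ[R] B) (i : ℕ) {r : R} (hr : ∀ y : K, r • y = 0) :
    extPrecomp K (r • f) i = 0 := by
  have h : r • 𝟙 (ModuleCat.of R K) = 0 := by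
    ext y
    exact hr y
  have h' : ModuleCat.ofHom (r • f) = r • ModuleCat.ofHom f := rfl
  ext x
  rw [extPrecomp_apply, h', Ext.mk₀_smul, Ext.smul_comp, Ext.smul_eq_comp_mk₀, h]
  simp

variable {K} in
lemma extLength_congr (e : A ≃ₗ[R] B) (i : ℕ) : extLength R K A i = extLength R K B i := by
  refine LinearEquiv.length_eq (LinearEquiv.ofLinearMap (extPrecomp K e.symm.toLinearMap i)
    (extPrecomp K e.toLinearMap i) ?_ ?_)
  · rw [← extPrecomp_comp, ← extPrecomp_id]
    congr 1
    ext
    simp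
  · rw [← extPrecomp_comp, ← extPrecomp_id]
    congr 1
    ext
    simp

variable {f : A →ₗ[R] B} {g : B →ₗ[R] C}

lemma extPrecomp_exact (hf : Function.Injective f) (hg : Function.Surjective g)
    (hfg : Function.Exact f g) (i : ℕ) :
    Function.Exact (extPrecomp K g i) (extPrecomp K f i) := by
  have hS : (ShortComplex.mk (ModuleCat.ofHom f) (ModuleCat.ofHom g)
      (by ext x; exact hfg.apply_apply_eq_zero x)).ShortExact :=
    ModuleCat.shortComplex_shortExact _ hfg hf hg
  intro x
  constructor
  · exact Ext.contravariant_sequence_exact₂ hS _ x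
  · rintro ⟨y, rfl⟩
    rw [← LinearMap.comp_apply, ← extPrecomp_comp, hfg.linearMap_comp_eq_zero]
    simpa using LinearMap.congr_fun
      (extPrecomp_smul_eq_zero K (0 : A →ₗ[R] C) i (r := 0) (by simp)) y

lemma extLength_zero_of_exact (hf : Function.Injective f) (hg : Function.Surjective g)
    (hfg : Function.Exact f g) (h : extPrecomp K f 0 = 0) :
    extLength R K C 0 = extLength R K B 0 := by
  have : Epi (ModuleCat.ofHom g) := (ModuleCat.epi_iff_surjective _).2 hg
  refine (LinearEquiv.ofBijective (extPrecomp K g 0)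
    ⟨Ext.precomp_mk₀_injective_of_epi _ (ModuleCat.ofHom g), fun x => ?_⟩).length_eq
  exact (extPrecomp_exact K hf hg hfg 0 x).1 (by simp [h])

lemma extLength_succ_of_exact (hf : Function.Injective f) (hg : Function.Surjective g)
    (hfg : Function.Exact f g) (h : ∀ i, extPrecomp K f i = 0) (i : ℕ) :
    extLength R K C (i + 1) = extLength R K A i + extLength R K B (i + 1) := by
  have hS : (ShortComplex.mk (ModuleCat.ofHom f) (ModuleCat.ofHom g)
      (by ext x; exact hfg.apply_apply_eq_zero x)).ShortExact :=
    ModuleCat.shortComplex_shortExact _ hfg hf hg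
  refine Module.length_eq_add_of_exact
    (hS.extClass.precompOfLinear R (ModuleCat.of R K) (add_comm 1 i)) (extPrecomp K g (i + 1))
    ?_ (fun x => (extPrecomp_exact K hf hg hfg _ x).1 (by simp [h])) (fun x => ⟨fun hx => ?_, ?_⟩)
  · rw [injective_iff_map_eq_zero]
    intro x hx
    obtain ⟨y, rfl⟩ := Ext.contravariant_sequence_exact₁ hS (ModuleCat.of R K) x
      (add_comm 1 i) hx
    exact LinearMap.congr_fun (h i) y
  · exact Ext.contravariant_sequence_exact₃ hS (ModuleCat.of R K) x hx (add_comm 1 i)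
  · rintro ⟨y, rfl⟩
    exact hS.comp_extClass_assoc y (add_comm 1 i)

lemma extLength_prod (i : ℕ) :
    extLength R K (A × B) i = extLength R K A i + extLength R K B i := by
  rw [add_comm]
  refine Module.length_eq_add_of_exact (extPrecomp K (LinearMap.snd R A B) i)
    (extPrecomp K (LinearMap.inl R A B) i) ?_ ?_
    (extPrecomp_exact K LinearMap.inl_injective LinearMap.snd_surjective
      Function.Exact.inl_snd i)
  · refine Function.LeftInverse.injective (g := extPrecomp K (LinearMap.inr R A B) i) fun x => ?_
    rw [← LinearMap.comp_apply, ← extPrecomp_comp, LinearMap.snd_comp_inr, extPrecomp_id,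
      LinearMap.id_apply]
  · refine Function.RightInverse.surjective (g := extPrecomp K (LinearMap.fst R A B) i)
      fun x => ?_
    rw [← LinearMap.comp_apply, ← extPrecomp_comp, LinearMap.fst_comp_inl, extPrecomp_id,
      LinearMap.id_apply]

lemma subsingleton_ext_of_free [Module.Free R A] (i : ℕ) :
    Subsingleton (Ext (ModuleCat.of R A) (ModuleCat.of R K) (i + 1)) := by
  have : Projective (ModuleCat.of R A) := (IsProjective.iff_projective A).1 inferInstance
  exact Ext.subsingleton_of_projective _ _ i

lemma extLength_succ_of_free [Module.Free R A] (i : ℕ) : extLength R K A (i + 1) = 0 :=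
  Module.length_eq_zero_iff.2 (subsingleton_ext_of_free K i)

lemma extLength_zero : extLength R K A 0 = Module.length R (A →ₗ[R] K) :=
  (Ext.linearEquiv₀.trans ModuleCat.homLinearEquiv).length_eq

lemma extLength_zero_finsupp [IsSimpleModule R K] (n : ℕ) :
    extLength R K (Fin n →₀ R) 0 = n := by
  rw [extLength_zero, (Finsupp.llift K R R (Fin n)).symm.length_eq, Module.length_pi_of_fintype]
  simp

/-- The inclusion of the first syzygy module induces zero on `Ext` if the presentation is
minimal. -/
lemma extPrecomp_subtype_range_eq_zero {m n : ℕ} (d : (Fin m →₀ R) →ₗ[R] (Fin n →₀ R))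
    (hmin : ∀ p q, ∀ y : K, d (Finsupp.single p 1) q • y = 0) (i : ℕ) :
    extPrecomp (R := R) (A := LinearMap.range d) (B := Fin n →₀ R) K
      (LinearMap.range d).subtype i = 0 := by
  cases i with
  | succ i =>
    have := subsingleton_ext_of_free (A := Fin n →₀ R) (R := R) K i
    ext x
    rw [Subsingleton.elim x 0, map_zero, map_zero]
  | zero =>
    have hd (φ : (Fin n →₀ R) →ₗ[R] K) : φ ∘ₗ d = 0 := by
      ext p
      have h : φ (d (Finsupp.single p 1)) = 0 := by
        rw [← Finsupp.sum_single (d (Finsupp.single p 1)), Finsupp.sum, map_sum]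
        refine Finset.sum_eq_zero fun q _ => ?_
        rw [← mul_one (d (Finsupp.single p 1) q), ← smul_eq_mul, ← Finsupp.smul_single,
          map_smul, hmin]
      simpa using h
    ext x
    obtain ⟨φ, rfl⟩ := (Ext.mk₀_bijective _ _).2 x
    rw [extPrecomp_apply, Ext.mk₀_comp_mk₀, LinearMap.zero_apply, Ext.mk₀_eq_zero_iff]
    ext ⟨_, w, rfl⟩
    exact LinearMap.congr_fun (hd φ.hom) w

/-- The ranks in a minimal free resolution are the lengths of the `Ext`-modules into `K`. -/
lemma extLength_eq_of_minimal_resolution [IsSimpleModule R K] (i : ℕ) (b : ℕ → ℕ)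
    (d : (i : ℕ) → (Fin (b (i + 1)) →₀ R) →ₗ[R] (Fin (b i) →₀ R))
    (ε : (Fin (b 0) →₀ R) →ₗ[R] A) (hε : Function.Surjective ε)
    (hd₀ : LinearMap.ker ε = LinearMap.range (d 0))
    (hd : ∀ i, LinearMap.ker (d i) = LinearMap.range (d (i + 1)))
    (hmin : ∀ i p q, ∀ y : K, d i (Finsupp.single p 1) q • y = 0) :
    extLength R K A i = b i := by
  have hex : Function.Exact (LinearMap.range (d 0)).subtype ε := by
    rw [← hd₀]
    exact LinearMap.exact_subtype_ker_map ε
  have hzero := extPrecomp_subtype_range_eq_zero K (d 0) (hmin 0)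
  induction i generalizing A b with
  | zero =>
    rw [extLength_zero_of_exact K (Submodule.subtype_injective _) hε hex (hzero 0),
      extLength_zero_finsupp]
  | succ i ih =>
    rw [extLength_succ_of_exact K (Submodule.subtype_injective _) hε hex hzero,
      extLength_succ_of_free, add_zero]
    refine ih (fun i => b (i + 1)) (fun i => d (i + 1)) (d 0).rangeRestrict
      (LinearMap.surjective_rangeRestrict _) ?_ (fun i => hd (i + 1)) (fun i => hmin (i + 1)) ?_
      (extPrecomp_subtype_range_eq_zero K (d 1) (hmin 1))
    · rw [LinearMap.ker_rangeRestrict, hd]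
    · rw [LinearMap.exact_iff, LinearMap.ker_rangeRestrict, hd, Submodule.range_subtype]

end ExtLength

section Mixed

lemma pow_succ_span_mul_sup_span {R : Type*} [CommRing R] (I : Ideal R) (x P : R) (s : ℕ) :
    (Ideal.span {x} * I ⊔ Ideal.span {P}) ^ (s + 1) =
      Ideal.span {P} * (Ideal.span {x} * I ⊔ Ideal.span {P}) ^ s ⊔
        Ideal.span {x ^ (s + 1)} * I ^ (s + 1) := by
  rw [← Ideal.span_singleton_pow, ← mul_pow]
  generalize Ideal.span {x} * I = a
  generalize Ideal.span {P} = b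
  induction s with
  | zero => simp [sup_comm]
  | succ s ih =>
    refine le_antisymm ?_ (sup_le ?_ (Ideal.pow_right_mono le_sup_left _))
    · calc (a ⊔ b) ^ (s + 1 + 1) = a * (a ⊔ b) ^ (s + 1) ⊔ b * (a ⊔ b) ^ (s + 1) := by
            rw [pow_succ', Ideal.sup_mul]
        _ = b * (a * (a ⊔ b) ^ s) ⊔ a ^ (s + 1 + 1) ⊔ b * (a ⊔ b) ^ (s + 1) := by
            conv_lhs => arg 1; rw [ih, Ideal.mul_sup, mul_left_comm, ← pow_succ']
        _ ≤ b * (a ⊔ b) ^ (s + 1) ⊔ a ^ (s + 1 + 1) := by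
            refine sup_le (sup_le_sup_right (Ideal.mul_mono_right ?_) _) le_sup_left
            rw [pow_succ']
            exact Ideal.mul_mono_left le_sup_left
    · rw [pow_succ' (a ⊔ b) (s + 1)]
      exact Ideal.mul_mono_left le_sup_right

universe u

variable {R : Type u} [CommRing R] (K : Type u) [AddCommGroup K] [Module R K]

/-- The short exact sequence `0 → I ^ s → L ^ s × I ^ (s + 1) → L ^ (s + 1) → 0` for
`L = x I + (P)`, where the first map is `h ↦ (x ^ (s + 1) h, - P h)`. -/
lemma exists_exact_pow_span_mul_sup_span [IsDomain R] (I : Ideal R) {x r p : R} (hx : Prime x)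
    (hxP : ¬ x ∣ r * p) (hp : p ∈ I) (s : ℕ) (hreg : ∀ h, x * h ∈ I ^ s → h ∈ I ^ s)
    (hxK : ∀ y : K, x • y = 0) (hrK : ∀ y : K, r • y = 0) (L : Ideal R)
    (hL : L = Ideal.span {x} * I ⊔ Ideal.span {r * p}) :
    ∃ (f : ↥(I ^ s) →ₗ[R] ↥(L ^ s) × ↥(I ^ (s + 1)))
      (g : ↥(L ^ s) × ↥(I ^ (s + 1)) →ₗ[R] ↥(L ^ (s + 1))),
      Function.Injective f ∧ Function.Surjective g ∧ Function.Exact f g ∧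
        ∀ i, extPrecomp K f i = 0 := by
  have hLpow : L ^ (s + 1) = Ideal.span {r * p} * L ^ s ⊔
      Ideal.span {x ^ (s + 1)} * I ^ (s + 1) := by
    rw [hL, pow_succ_span_mul_sup_span]
  have hLI : L ≤ I := by
    rw [hL]
    exact sup_le Ideal.mul_le_right
      ((Ideal.span_singleton_le_iff_mem _).2 (I.mul_mem_left _ hp))
  have hα : ∀ h ∈ I ^ s, LinearMap.mulLeft R (x ^ s) h ∈ L ^ s := fun h hh => by
    have : Ideal.span {x ^ s} * I ^ s ≤ L ^ s := by
      rw [← Ideal.span_singleton_pow, ← mul_pow, hL]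
      exact Ideal.pow_right_mono le_sup_left _
    exact this (Ideal.mul_mem_mul (Ideal.mem_span_singleton_self _) hh)
  have hβ : ∀ h ∈ I ^ s, LinearMap.mulLeft R p h ∈ I ^ (s + 1) := fun h hh => by
    rw [pow_succ']
    exact Ideal.mul_mem_mul hp hh
  have hγ : ∀ h ∈ L ^ s, LinearMap.mulLeft R (r * p) h ∈ L ^ (s + 1) := fun h hh => by
    rw [hLpow]
    exact Ideal.mem_sup_left (Ideal.mul_mem_mul (Ideal.mem_span_singleton_self _) hh)
  have hδ : ∀ h ∈ I ^ (s + 1), LinearMap.mulLeft R (x ^ (s + 1)) h ∈ L ^ (s + 1) :=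
    fun h hh => by
      rw [hLpow]
      exact Ideal.mem_sup_right (Ideal.mul_mem_mul (Ideal.mem_span_singleton_self _) hh)
  refine ⟨x • (LinearMap.inl R _ _ ∘ₗ (LinearMap.mulLeft R (x ^ s)).restrict hα) +
    r • (LinearMap.inr R _ _ ∘ₗ (-(LinearMap.mulLeft R p).restrict hβ)),
    ((LinearMap.mulLeft R (r * p)).restrict hγ).coprod
      ((LinearMap.mulLeft R (x ^ (s + 1))).restrict hδ), ?_, ?_, ?_, fun i => ?_⟩
  · rw [injective_iff_map_eq_zero]
    intro h hh
    have := congr_arg Subtype.val (congr_arg Prod.fst hh)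
    simpa [hx.ne_zero] using this
  · rintro ⟨z, hz⟩
    rw [hLpow] at hz
    obtain ⟨a, ha, c, hc, rfl⟩ := Submodule.mem_sup.1 hz
    obtain ⟨u, hu, rfl⟩ := Ideal.mem_span_singleton_mul.1 ha
    obtain ⟨v, hv, rfl⟩ := Ideal.mem_span_singleton_mul.1 hc
    exact ⟨(⟨u, hu⟩, ⟨v, hv⟩), rfl⟩
  · rintro ⟨⟨u, hu⟩, ⟨v, hv⟩⟩
    constructor
    · intro h
      replace h : r * p * u + x ^ (s + 1) * v = 0 := congr_arg Subtype.val h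
      obtain ⟨w, rfl⟩ := hx.pow_dvd_of_dvd_mul_left (s + 1) hxP
        (⟨-v, by linear_combination h⟩ : x ^ (s + 1) ∣ r * p * u)
      have hv' : v = -(r * p * w) :=
        mul_left_cancel₀ (pow_ne_zero (s + 1) hx.ne_zero) (by linear_combination h)
      have hpow (t : ℕ) : x ^ t * w ∈ I ^ s → w ∈ I ^ s := by
        induction t with
        | zero => simp
        | succ t ih => exact fun h => ih (hreg _ (by rwa [← mul_assoc, ← pow_succ']))
      refine ⟨⟨w, hpow _ (Ideal.pow_right_mono hLI s hu)⟩, ?_⟩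
      ext
      · simp [pow_succ', mul_assoc]
      · simp [hv', mul_assoc]
    · rintro ⟨w, hw⟩
      have h₁ := congr_arg Subtype.val (congr_arg Prod.fst hw)
      have h₂ := congr_arg Subtype.val (congr_arg Prod.snd hw)
      replace h₁ : x * (x ^ s * w.1) + r * 0 = u := h₁
      replace h₂ : x * 0 + r * -(p * w.1) = v := h₂
      refine Subtype.ext ?_
      change r * p * u + x ^ (s + 1) * v = 0
      rw [← h₁, ← h₂]
      ring
  · rw [extPrecomp_add, extPrecomp_smul_eq_zero K _ i hxK, extPrecomp_smul_eq_zero K _ i hrK,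
      add_zero]

lemma extLength_of_eq_top [IsSimpleModule R K] {I : Ideal R} (hI : I = ⊤) (i : ℕ) :
    extLength R K I i = (if i = 0 then 1 else 0 : ℕ) := by
  subst hI
  rw [extLength_congr Submodule.topEquiv]
  cases i with
  | zero => simp [extLength_zero, (LinearMap.ringLmapEquivSelf R R K).length_eq]
  | succ i => simp [extLength_succ_of_free]

end Mixed

section CoverIdeal

open MvPolynomial

variable {σ k : Type*} [Field k]

lemma not_X_dvd_prod_X {x : σ} {A : Finset σ} (hx : x ∉ A) :
    ¬ (X x : MvPolynomial σ k) ∣ ∏ j ∈ A, X j := by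
  intro h
  obtain ⟨j, hj, hxj⟩ := (X_prime.dvd_finsetProd_iff _).1 h
  exact hx (X_dvd_X.1 hxj ▸ hj)

variable [DecidableEq σ]

/-- The cover ideal of the complete graph on the vertex set `A`. -/
noncomputable def completeCoverIdeal (k : Type*) [Field k] (A : Finset σ) :
    Ideal (MvPolynomial σ k) :=
  Ideal.span ((fun i => ∏ j ∈ A.erase i, X j) '' (A : Set σ))

lemma completeCoverIdeal_insert {x : σ} {A : Finset σ} (hx : x ∉ A) :
    completeCoverIdeal k (insert x A) =
      Ideal.span {X x} * completeCoverIdeal k A ⊔ Ideal.span {∏ j ∈ A, X j} := by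
  rw [completeCoverIdeal, Finset.coe_insert, Set.image_insert_eq, Ideal.span_insert,
    Finset.erase_insert hx, sup_comm, completeCoverIdeal, Ideal.span_mul_span', Set.singleton_mul,
    Set.image_image]
  congr 2
  refine Set.image_congr fun i hi => ?_
  have hxi : i ≠ x := fun h => hx (h ▸ hi)
  rw [Finset.erase_insert_of_ne hxi.symm,
    Finset.prod_insert (fun h => hx (Finset.mem_of_mem_erase h))]

lemma exists_completeCoverIdeal_pow_eq {x : σ} {A : Finset σ} (hx : x ∉ A) (a : ℕ) :
    ∃ t : Set (σ →₀ ℕ), (∀ e ∈ t, e x = 0) ∧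
      completeCoverIdeal k A ^ a = Ideal.span ((fun e => monomial e (1 : k)) '' t) := by
  induction a with
  | zero => exact ⟨{0}, by simp, by simp [Ideal.one_eq_top]⟩
  | succ a ih =>
    obtain ⟨t, ht, hta⟩ := ih
    refine ⟨Set.image2 (fun e i => e + ∑ j ∈ A.erase i, Finsupp.single j 1) t A, ?_, ?_⟩
    · rintro _ ⟨e, he, i, -, rfl⟩
      have : ∑ j ∈ A.erase i, Finsupp.single j 1 x = 0 :=
        Finset.sum_eq_zero fun j hj => Finsupp.single_eq_of_ne
          (fun h => hx (h ▸ Finset.mem_of_mem_erase hj))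
      simp [ht e he, this]
    · rw [pow_succ, hta, completeCoverIdeal, Ideal.span_mul_span', ← Set.image2_mul,
        Set.image2_image_left, Set.image2_image_right, Set.image_image2]
      congr 1
      refine Set.image2_congr fun e _ i _ => ?_
      have h : ∏ j ∈ A.erase i, (X j : MvPolynomial σ k) =
          monomial (∑ j ∈ A.erase i, Finsupp.single j 1) 1 := by
        rw [monomial_sum_one]
        rfl
      rw [h, monomial_mul, one_mul]

lemma mem_completeCoverIdeal_pow_of_X_mul_mem {x : σ} {A : Finset σ} (hx : x ∉ A) {a : ℕ}
    {h : MvPolynomial σ k} (hh : X x * h ∈ completeCoverIdeal k A ^ a) :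
    h ∈ completeCoverIdeal k A ^ a := by
  obtain ⟨t, ht, hta⟩ := exists_completeCoverIdeal_pow_eq (k := k) hx a
  rw [hta, mem_ideal_span_monomial_image] at hh ⊢
  intro m hm
  obtain ⟨e, he, hle⟩ := hh (Finsupp.single x 1 + m) (by
    rw [mem_support_iff, coeff_X_mul]
    exact mem_support_iff.1 hm)
  refine ⟨e, he, fun j => ?_⟩
  obtain rfl | hj := eq_or_ne j x
  · simp [ht e he]
  · simpa [Finsupp.single_eq_of_ne hj] using hle j

end CoverIdeal

section Betti

open MvPolynomial

universe u

variable {σ : Type} [DecidableEq σ] {k : Type u} [Field k] (K : Type u) [AddCommGroup K]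
  [Module (MvPolynomial σ k) K] [IsSimpleModule (MvPolynomial σ k) K]

lemma extLength_completeCoverIdeal_pow
    (hK : ∀ (j : σ) (y : K), (X j : MvPolynomial σ k) • y = 0) {A : Finset σ} (m : ℕ)
    (hA : A.card = m + 1) (s i : ℕ) :
    extLength (MvPolynomial σ k) K ↥(completeCoverIdeal k A ^ s) i =
      (m.choose i * (m - i + s).choose m : ℕ) := by
  induction m generalizing A s i with
  | zero =>
    obtain ⟨a, rfl⟩ := Finset.card_eq_one.1 hA
    have htop : completeCoverIdeal k {a} ^ s = ⊤ := by
      have : completeCoverIdeal k {a} = ⊤ := by simp [completeCoverIdeal]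
      rw [this, ← Ideal.one_eq_top, one_pow]
    rw [extLength_of_eq_top K htop]
    cases i <;> simp
  | succ m ih =>
    obtain ⟨x, A, hx, rfl, hAm⟩ := Finset.card_eq_succ.1 hA
    obtain ⟨a, ha⟩ : A.Nonempty := Finset.card_pos.1 (by lia)
    have hprod : ∏ j ∈ A, (X j : MvPolynomial σ k) = X a * ∏ j ∈ A.erase a, X j :=
      (Finset.mul_prod_erase _ _ ha).symm
    induction s generalizing i with
    | zero =>
      rw [extLength_of_eq_top K (by rw [pow_zero, Ideal.one_eq_top])]
      cases i with
      | zero => simp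
      | succ i => simp [Nat.choose_eq_zero_of_lt (show m - i < m + 1 by lia)]
    | succ s ihs =>
      obtain ⟨f, g, hf, hg, hfg, h⟩ := exists_exact_pow_span_mul_sup_span K
        (completeCoverIdeal k A) X_prime (hprod ▸ not_X_dvd_prod_X hx)
        (Ideal.subset_span ⟨a, ha, rfl⟩) s
        (fun _ => mem_completeCoverIdeal_pow_of_X_mul_mem hx) (hK x) (hK a) _
        (hprod ▸ completeCoverIdeal_insert hx)
      cases i with
      | zero =>
        rw [extLength_zero_of_exact K hf hg hfg (h 0), extLength_prod, ihs, ih hAm]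
        norm_cast
        simp only [Nat.choose_zero_right, one_mul, Nat.sub_zero]
        rw [← add_assoc (m + 1), Nat.choose_succ_succ' (m + 1 + s), add_right_comm m 1 s,
          add_assoc m s 1, add_comm]
      | succ i =>
        rw [extLength_succ_of_exact K hf hg hfg h, extLength_prod, ihs, ih hAm, ih hAm]
        norm_cast
        rw [Nat.add_sub_add_right, ← add_assoc (m - i), Nat.choose_succ_succ' (m - i + s),
          Nat.choose_succ_succ' m i]
        obtain him | him := le_or_gt (i + 1) m
        · rw [show m - (i + 1) + (s + 1) = m - i + s by lia]
          ring
        · rw [Nat.choose_eq_zero_of_lt him]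
          ring

end Betti

/-- The total Betti numbers of the `s`-th power of the cover ideal
`J(K_n) = ⟨X_1⋯X_n/X_i : i ∈ [n]⟩` of the complete graph are
`β_i(J(K_n)^s) = C(n-1,i)·C(n-1-i+s,n-1)`. -/
theorem betti_power_cover_ideal_complete_graph
    {k : Type*} [Field k] (n s : ℕ) (hn : 1 ≤ n) (hs : 1 ≤ s)
    (J : Ideal (MvPolynomial (Fin n) k))
    (hJ : J = Ideal.span (Set.range fun i : Fin n =>
        ∏ j ∈ Finset.univ.erase i, X j))
    (b : ℕ → ℕ) (hb : IsMinimalFreeResolution k n b ↥(J ^ s)) :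
    ∀ i, b i = Nat.choose (n - 1) i * Nat.choose (n - 1 - i + s) (n - 1) := by
  intro i
  obtain ⟨d, ε, hε, hd₀, hd, hmin⟩ := hb
  let 𝔪 : Ideal (MvPolynomial (Fin n) k) := RingHom.ker constantCoeff
  have : 𝔪.IsMaximal :=
    RingHom.ker_isMaximal_of_surjective _ fun c => ⟨C c, constantCoeff_C _ c⟩
  have : IsSimpleModule (MvPolynomial (Fin n) k) (MvPolynomial (Fin n) k ⧸ 𝔪) :=
    isSimpleModule_iff_isCoatom.2 this.out
  have hsmul (c : MvPolynomial (Fin n) k) (hc : constantCoeff c = 0)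
      (y : MvPolynomial (Fin n) k ⧸ 𝔪) : c • y = 0 := by
    obtain ⟨y, rfl⟩ := Ideal.Quotient.mk_surjective y
    rw [Algebra.smul_def, Ideal.Quotient.algebraMap_eq, ← map_mul, Ideal.Quotient.eq_zero_iff_mem]
    exact Ideal.mul_mem_right _ _ hc
  have hJ' : J = completeCoverIdeal k Finset.univ := by
    rw [hJ, completeCoverIdeal, Finset.coe_univ, Set.image_univ]
  have h₁ := extLength_eq_of_minimal_resolution (MvPolynomial (Fin n) k ⧸ 𝔪) i b d ε hε hd₀ hd
    (fun i p q => hsmul _ (hmin i p q))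
  subst hJ'
  rw [extLength_completeCoverIdeal_pow _ (fun j => hsmul _ (constantCoeff_X _ j)) (n - 1)
    (by rw [Finset.card_univ, Fintype.card_fin]; lia)] at h₁
  exact_mod_cast h₁.symm
end

section
/- Let S = k[X_1,…,X_n] with each variable X_i assigned weight w_i, where w_1 ≤ w_2 ≤ ⋯ ≤ w_n, and let J(K_n) be the cover ideal of the complete graph on X_1,…,X_n. Then the weighted Castelnuovo–Mumford regularity of S/J(K_n)^s equals s·∑_{l=1}^n w_l − (s+1) if s < n−1, and equals s·∑_{l=1}^n w_l − w_1(s−n+1) − n if s ≥ n−1. -/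
open MvPolynomial

section GradedFreeModules

variable {k : Type*} [Field k] {σ : Type*} {ι κ : Type*} {M : Type*} [AddCommGroup M]
  [Module (MvPolynomial σ k) M]

/-- An element of the free module on `ι` is homogeneous of degree `D`, where the variables have
weights `w` and the basis element indexed by `q` has degree `a q`. -/
def IsHomog (w : σ → ℕ) (a : ι → ℕ) (D : ℕ) (f : ι →₀ MvPolynomial σ k) : Prop :=
  ∀ q u, coeff u (f q) ≠ 0 → Finsupp.weight w u + a q = D

theorem addMonoidHom_ext_single_monomial {N : Type*} [AddCommGroup N]
    {f g : (ι →₀ MvPolynomial σ k) →+ N}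
    (h : ∀ q u c, f (Finsupp.single q (monomial u c)) = g (Finsupp.single q (monomial u c))) :
    f = g := by
  refine Finsupp.addHom_ext fun q p => ?_
  induction p using MvPolynomial.induction_on' with
  | monomial u c => exact h q u c
  | add p₁ p₂ h₁ h₂ => rw [Finsupp.single_add, map_add, map_add, h₁, h₂]

/-- The homogeneous component of degree `D` of an element of a graded free module. -/
noncomputable def homogComponent (w : σ → ℕ) (a : ι → ℕ) (D : ℕ) :
    (ι →₀ MvPolynomial σ k) →+ (ι →₀ MvPolynomial σ k) where
  toFun f := Finsupp.onFinset f.support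
    (fun q => if a q ≤ D then weightedHomogeneousComponent w (D - a q) (f q) else 0) (by
      intro q hq
      rw [Finsupp.mem_support_iff]
      rintro h
      simp [h] at hq)
  map_zero' := by ext; simp
  map_add' f g := by
    ext q : 1
    by_cases h : a q ≤ D <;> simp [h]

theorem coeff_homogComponent (w : σ → ℕ) (a : ι → ℕ) (D : ℕ) (f : ι →₀ MvPolynomial σ k)
    (q : ι) (u : σ →₀ ℕ) : coeff u (homogComponent w a D f q) =
      if Finsupp.weight w u + a q = D then coeff u (f q) else 0 := by
  change coeff u (if a q ≤ D then weightedHomogeneousComponent w (D - a q) (f q) else 0) = _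
  by_cases h : a q ≤ D
  · rw [if_pos h, coeff_weightedHomogeneousComponent]
    congr 1
    apply propext
    omega
  · rw [if_neg h, if_neg (by omega), coeff_zero]

theorem isHomog_homogComponent (w : σ → ℕ) (a : ι → ℕ) (D : ℕ) (f : ι →₀ MvPolynomial σ k) :
    IsHomog w a D (homogComponent w a D f) := by
  intro q u h
  rw [coeff_homogComponent] at h
  by_contra h'
  exact h (if_neg h')

theorem IsHomog.homogComponent {w : σ → ℕ} {a : ι → ℕ} {D' : ℕ} {f : ι →₀ MvPolynomial σ k}
    (hf : IsHomog w a D' f) (D : ℕ) :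
    homogComponent w a D f = if D = D' then f else 0 := by
  ext q u
  rw [coeff_homogComponent]
  by_cases h0 : coeff u (f q) = 0
  · split_ifs <;> simp [h0]
  · have := hf q u h0
    subst this
    by_cases h : D = Finsupp.weight w u + a q
    · simp [h]
    · rw [if_neg h, if_neg (fun h' => h h'.symm)]
      simp

theorem isHomog_zero (w : σ → ℕ) (a : ι → ℕ) (D : ℕ) :
    IsHomog w a D (0 : ι →₀ MvPolynomial σ k) := by
  intro q u h
  simp at h

theorem IsHomog.add {w : σ → ℕ} {a : ι → ℕ} {D : ℕ} {f g : ι →₀ MvPolynomial σ k}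
    (hf : IsHomog w a D f) (hg : IsHomog w a D g) : IsHomog w a D (f + g) := by
  intro q u h
  by_cases h' : coeff u (f q) = 0
  · refine hg q u fun h'' => h ?_
    simp [h', h'']
  · exact hf q u h'

theorem IsHomog.neg {w : σ → ℕ} {a : ι → ℕ} {D : ℕ} {f : ι →₀ MvPolynomial σ k}
    (hf : IsHomog w a D f) : IsHomog w a D (-f) := by
  intro q u h
  exact hf q u (by simpa using h)

theorem isHomog_single_monomial (w : σ → ℕ) (a : ι → ℕ) (q : ι) (u : σ →₀ ℕ) (c : k) :
    IsHomog w a (Finsupp.weight w u + a q) (Finsupp.single q (monomial u c)) := by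
  classical
  intro q' u' h
  rw [Finsupp.single_apply] at h
  split_ifs at h with hq
  · rw [coeff_monomial] at h
    split_ifs at h with hu
    · rw [hu, hq]
    · simp at h
  · simp at h

theorem isHomog_single_one (w : σ → ℕ) (a : ι → ℕ) (q : ι) :
    IsHomog w a (a q) (Finsupp.single q (1 : MvPolynomial σ k)) := by
  simpa using isHomog_single_monomial (k := k) w a q 0 1

/-- Additive maps picking out the homogeneous components with respect to the homogeneous
elements `H`. -/
def IsComponentFamily (H : ℕ → Set M) (c : ℕ → M →+ M) : Prop :=
  ∀ d e x, x ∈ H e → c d x = if d = e then x else 0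

theorem map_homogComponent {N : Type*} [AddCommGroup N] {w : σ → ℕ} {a : ι → ℕ}
    {H : ℕ → Set N} {c : ℕ → N →+ N}
    (hc : IsComponentFamily H c) (L : (ι →₀ MvPolynomial σ k) →+ N)
    (hL : ∀ D f, IsHomog w a D f → L f ∈ H D) (D : ℕ) (f : ι →₀ MvPolynomial σ k) :
    L (homogComponent w a D f) = c D (L f) := by
  suffices h : L.comp (homogComponent w a D) = (c D).comp L from DFunLike.congr_fun h f
  refine addMonoidHom_ext_single_monomial fun q u r => ?_
  have h := isHomog_single_monomial w a q u r
  rw [AddMonoidHom.comp_apply, AddMonoidHom.comp_apply, h.homogComponent,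
    hc D _ _ (hL _ _ h)]
  split_ifs <;> simp

theorem isComponentFamily_homogComponent (w : σ → ℕ) (a : ι → ℕ) :
    IsComponentFamily (fun D => {f : ι →₀ MvPolynomial σ k | IsHomog w a D f})
      (homogComponent w a) := fun d _ _ hx => IsHomog.homogComponent hx d

/-- A map of free modules over the polynomial ring that respects the degrees. -/
def IsGradedMap (w : σ → ℕ) (a : ι → ℕ) (b : κ → ℕ)
    (L : (ι →₀ MvPolynomial σ k) →ₗ[MvPolynomial σ k] (κ →₀ MvPolynomial σ k)) : Prop :=
  ∀ D f, IsHomog w a D f → IsHomog w b D (L f)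

theorem IsGradedMap.homogComponent {w : σ → ℕ} {a : ι → ℕ} {b : κ → ℕ}
    {L : (ι →₀ MvPolynomial σ k) →ₗ[MvPolynomial σ k] (κ →₀ MvPolynomial σ k)}
    (hL : IsGradedMap w a b L) (D : ℕ) (f : ι →₀ MvPolynomial σ k) :
    L (homogComponent w a D f) = _root_.homogComponent w b D (L f) :=
  map_homogComponent (isComponentFamily_homogComponent w b) L.toAddMonoidHom hL D f

theorem isGradedMap_of_single {w : σ → ℕ} {a : ι → ℕ} {b : κ → ℕ}
    {L : (ι →₀ MvPolynomial σ k) →ₗ[MvPolynomial σ k] (κ →₀ MvPolynomial σ k)}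
    (hL : ∀ q, IsHomog w b (a q) (L (Finsupp.single q 1))) : IsGradedMap w a b L := by
  classical
  intro D f hf
  rw [← Finsupp.sum_single f, Finsupp.sum, map_sum]
  refine Finset.sum_induction _ (IsHomog w b D) (fun _ _ => IsHomog.add)
    (isHomog_zero _ _ _) fun q _ => ?_
  rw [← mul_one (f q), ← smul_eq_mul, ← Finsupp.smul_single, map_smul]
  intro r u hu
  rw [Finsupp.smul_apply, smul_eq_mul, coeff_mul] at hu
  obtain ⟨⟨u₁, u₂⟩, hu₁, hu₂⟩ := Finset.exists_ne_zero_of_sum_ne_zero hu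
  rw [Finset.HasAntidiagonal.mem_antidiagonal] at hu₁
  have h₁ := hf q u₁ (left_ne_zero_of_mul hu₂)
  have h₂ := hL q r u₂ (right_ne_zero_of_mul hu₂)
  simp only at hu₁
  rw [← hu₁, map_add]
  omega

theorem exists_isHomog_preimage {w : σ → ℕ} {a : ι → ℕ} {H : ℕ → Set M} {c : ℕ → M →+ M}
    (hc : IsComponentFamily H c)
    (L : (ι →₀ MvPolynomial σ k) →ₗ[MvPolynomial σ k] M)
    (hL : ∀ D f, IsHomog w a D f → L f ∈ H D) {D : ℕ} {x : M} (hx : x ∈ H D)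
    (hr : x ∈ LinearMap.range L) : ∃ f, IsHomog w a D f ∧ L f = x := by
  obtain ⟨f, rfl⟩ := hr
  refine ⟨homogComponent w a D f, isHomog_homogComponent w a D f, ?_⟩
  have := map_homogComponent hc L.toAddMonoidHom hL D f
  simp only [LinearMap.toAddMonoidHom_coe] at this
  rw [this, hc D D _ hx, if_pos rfl]

theorem exists_lift {R P Q : Type*} [CommRing R] [AddCommGroup P] [Module R P] [AddCommGroup Q]
    [Module R Q] (L : P →ₗ[R] Q) (g : (ι →₀ R) →ₗ[R] Q) (C : ι → P → Prop)
    (h : ∀ q, ∃ x, C q x ∧ L x = g (Finsupp.single q 1)) :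
    ∃ l : (ι →₀ R) →ₗ[R] P, (∀ q, C q (l (Finsupp.single q 1))) ∧ ∀ x, L (l x) = g x := by
  choose x hx hx' using h
  refine ⟨Finsupp.linearCombination R x, fun q => by simpa using hx q, fun y => ?_⟩
  suffices h : L ∘ₗ Finsupp.linearCombination R x = g from LinearMap.congr_fun h y
  ext q
  simp [hx']

theorem exists_lift_of_forall_mem_range {R P Q : Type*} [CommRing R] [AddCommGroup P] [Module R P]
    [AddCommGroup Q] [Module R Q] (L : P →ₗ[R] Q) (g : (ι →₀ R) →ₗ[R] Q)
    (h : ∀ x, g x ∈ LinearMap.range L) :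
    ∃ l : (ι →₀ R) →ₗ[R] P, ∀ x, L (l x) = g x := by
  obtain ⟨l, -, hl⟩ := exists_lift L g (fun _ _ => True) fun q => by
    obtain ⟨x, hx⟩ := h (Finsupp.single q 1)
    exact ⟨x, trivial, hx⟩
  exact ⟨l, hl⟩

/-- The combination with polynomial coefficients of elements with zero constant coefficient. -/
theorem constantCoeff_apply_eq_zero
    (L : (ι →₀ MvPolynomial σ k) →ₗ[MvPolynomial σ k] (κ →₀ MvPolynomial σ k)) (q : κ)
    (f : ι →₀ MvPolynomial σ k)
    (h : ∀ p, constantCoeff (f p) = 0 ∨ constantCoeff (L (Finsupp.single p 1) q) = 0) :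
    constantCoeff (L f q) = 0 := by
  conv_lhs => rw [← Finsupp.sum_single f]
  rw [Finsupp.sum, map_sum, Finsupp.finsetSum_apply, map_sum]
  refine Finset.sum_eq_zero fun p _ => ?_
  rw [← mul_one (f p), ← smul_eq_mul, ← Finsupp.smul_single, map_smul, Finsupp.smul_apply,
    smul_eq_mul, map_mul]
  rcases h p with h | h <;> simp [h]

end GradedFreeModules

section Comparison

variable {k : Type*} [Field k] {σ : Type*} {M : Type*} [AddCommGroup M]
  [Module (MvPolynomial σ k) M]

/-- The maps `d`, `ε` form a minimal graded free resolution of `M`, whose `i`-th term has basis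
`ι i` with degrees `a i`. -/
structure IsMinGradedRes (w : σ → ℕ) {ι : ℕ → Type} (a : ∀ i, ι i → ℕ) (H : ℕ → Set M)
    (d : ∀ i, (ι (i + 1) →₀ MvPolynomial σ k) →ₗ[MvPolynomial σ k] (ι i →₀ MvPolynomial σ k))
    (ε : (ι 0 →₀ MvPolynomial σ k) →ₗ[MvPolynomial σ k] M) : Prop where
  surj : Function.Surjective ε
  ker_aug : LinearMap.ker ε = LinearMap.range (d 0)
  exact : ∀ i, LinearMap.ker (d i) = LinearMap.range (d (i + 1))
  min : ∀ i f q, constantCoeff (d i f q) = 0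
  graded : ∀ i, IsGradedMap w (a (i + 1)) (a i) (d i)
  graded_aug : ∀ D f, IsHomog w (a 0) D f → ε f ∈ H D

theorem exists_degree_eq_of_constantCoeff {w : σ → ℕ} {ι κ : Type*} {a : ι → ℕ} {b : κ → ℕ}
    {φ : (ι →₀ MvPolynomial σ k) →ₗ[MvPolynomial σ k] (κ →₀ MvPolynomial σ k)}
    {ψ : (κ →₀ MvPolynomial σ k) →ₗ[MvPolynomial σ k] (ι →₀ MvPolynomial σ k)}
    (hφ : ∀ q, IsHomog w b (a q) (φ (Finsupp.single q 1))) (p : ι)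
    (h : constantCoeff (ψ (φ (Finsupp.single p 1)) p) ≠ 0) : ∃ q, b q = a p := by
  by_contra! hne
  refine h (constantCoeff_apply_eq_zero ψ p _ fun q => Or.inl ?_)
  by_contra h0
  have := hφ p q 0 h0
  simp at this
  exact hne q this

theorem IsMinGradedRes.exists_degree_eq {w : σ → ℕ} {ι κ : ℕ → Type} {a : ∀ i, ι i → ℕ}
    {b : ∀ i, κ i → ℕ} {H : ℕ → Set M} {c : ℕ → M →+ M} (hc : IsComponentFamily H c)
    {d : ∀ i, (ι (i + 1) →₀ MvPolynomial σ k) →ₗ[MvPolynomial σ k] (ι i →₀ MvPolynomial σ k)}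
    {ε : (ι 0 →₀ MvPolynomial σ k) →ₗ[MvPolynomial σ k] M}
    {d' : ∀ i, (κ (i + 1) →₀ MvPolynomial σ k) →ₗ[MvPolynomial σ k] (κ i →₀ MvPolynomial σ k)}
    {ε' : (κ 0 →₀ MvPolynomial σ k) →ₗ[MvPolynomial σ k] M}
    (hF : IsMinGradedRes w a H d ε) (hG : IsMinGradedRes w b H d' ε') (i : ℕ) (p : ι i) :
    ∃ q, b i q = a i p := by
  suffices key : ∃ (φ : (ι i →₀ MvPolynomial σ k) →ₗ[MvPolynomial σ k] (κ i →₀ MvPolynomial σ k))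
      (ψ : (κ i →₀ MvPolynomial σ k) →ₗ[MvPolynomial σ k] (ι i →₀ MvPolynomial σ k))
      (h : (ι i →₀ MvPolynomial σ k) →ₗ[MvPolynomial σ k] (ι (i + 1) →₀ MvPolynomial σ k)),
      (∀ q, IsHomog w (b i) (a i q) (φ (Finsupp.single q 1))) ∧
      (∀ x, φ (d i x) ∈ LinearMap.range (d' i)) ∧
      (∀ x, ψ (d' i x) ∈ LinearMap.range (d i)) ∧
      (∀ x, d i (h (d i x)) = ψ (φ (d i x)) - d i x) ∧
      (∀ q, constantCoeff (ψ (φ (Finsupp.single q 1)) q) = 1) by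
    obtain ⟨φ, ψ, h, hφ, -, -, -, hone⟩ := key
    exact exists_degree_eq_of_constantCoeff hφ p (by rw [hone]; exact one_ne_zero)
  clear p
  induction i with
  | zero =>
    obtain ⟨φ, hφ, hφ'⟩ := exists_lift ε' ε (fun q x => IsHomog w (b 0) (a 0 q) x) fun q =>
      exists_isHomog_preimage hc ε' hG.graded_aug
        (hF.graded_aug _ _ (isHomog_single_one w (a 0) q)) (hG.surj _)
    obtain ⟨ψ, hψ⟩ := exists_lift_of_forall_mem_range ε ε' fun x => hF.surj _
    have hd : ∀ x, ε (d 0 x) = 0 := fun x => by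
      have : d 0 x ∈ LinearMap.ker ε := hF.ker_aug ▸ ⟨x, rfl⟩
      exact this
    have hd' : ∀ x, ε' (d' 0 x) = 0 := fun x => by
      have : d' 0 x ∈ LinearMap.ker ε' := hG.ker_aug ▸ ⟨x, rfl⟩
      exact this
    obtain ⟨h, hh⟩ := exists_lift_of_forall_mem_range (d 0) (ψ ∘ₗ φ - LinearMap.id) fun x => by
      rw [← hF.ker_aug, LinearMap.mem_ker]
      simp [hψ, hφ']
    simp only [LinearMap.sub_apply, LinearMap.comp_apply, LinearMap.id_apply] at hh
    refine ⟨φ, ψ, h, hφ, fun x => ?_, fun x => ?_, fun x => hh _, fun q => ?_⟩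
    · rw [← hG.ker_aug, LinearMap.mem_ker, hφ', hd]
    · rw [← hF.ker_aug, LinearMap.mem_ker, hψ, hd']
    · have h1 := hF.min 0 (h (Finsupp.single q 1)) q
      rw [hh, Finsupp.sub_apply, map_sub, sub_eq_zero] at h1
      rw [h1]
      simp
  | succ i ih =>
    obtain ⟨φ, ψ, h, hφ, hφr, hψr, hhd, -⟩ := ih
    have hd : ∀ x, d i (d (i + 1) x) = 0 := fun x => by
      have : d (i + 1) x ∈ LinearMap.ker (d i) := hF.exact i ▸ ⟨x, rfl⟩
      exact this
    have hd' : ∀ x, d' i (d' (i + 1) x) = 0 := fun x => by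
      have : d' (i + 1) x ∈ LinearMap.ker (d' i) := hG.exact i ▸ ⟨x, rfl⟩
      exact this
    have hφg : IsGradedMap w (a i) (b i) φ := isGradedMap_of_single hφ
    obtain ⟨φ₁, hφ₁, hφ₁'⟩ := exists_lift (d' i) (φ ∘ₗ d i)
      (fun q x => IsHomog w (b (i + 1)) (a (i + 1) q) x) fun q =>
      exists_isHomog_preimage (isComponentFamily_homogComponent w (b i)) (d' i) (hG.graded i)
        (hφg _ _ (hF.graded i _ _ (isHomog_single_one w (a (i + 1)) q))) (hφr _)
    obtain ⟨ψ₁, hψ₁⟩ := exists_lift_of_forall_mem_range (d i) (ψ ∘ₗ d' i) fun x => hψr x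
    simp only [LinearMap.comp_apply] at hφ₁' hψ₁
    obtain ⟨h₁, hh₁⟩ := exists_lift_of_forall_mem_range (d (i + 1))
      (ψ₁ ∘ₗ φ₁ - LinearMap.id - h ∘ₗ d i) fun x => by
        rw [← hF.exact i, LinearMap.mem_ker]
        simp [hψ₁, hφ₁', hhd]
    simp only [LinearMap.sub_apply, LinearMap.comp_apply, LinearMap.id_apply] at hh₁
    refine ⟨φ₁, ψ₁, h₁, hφ₁, fun x => ?_, fun x => ?_, fun x => ?_, fun q => ?_⟩
    · rw [← hG.exact, LinearMap.mem_ker, hφ₁', hd, map_zero]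
    · rw [← hF.exact, LinearMap.mem_ker, hψ₁, hd', map_zero]
    · rw [hh₁, hd, map_zero, sub_zero]
    · have h1 := hF.min (i + 1) (h₁ (Finsupp.single q 1)) q
      have h2 : constantCoeff (h (d i (Finsupp.single q 1)) q) = 0 :=
        constantCoeff_apply_eq_zero h q _ fun p => Or.inl (hF.min i _ p)
      rw [hh₁, Finsupp.sub_apply, Finsupp.sub_apply, map_sub, map_sub, h2, sub_zero,
        sub_eq_zero] at h1
      rw [h1]
      simp

end Comparison

section KoszulIdeal

variable {k : Type*} [Field k] {n : ℕ}

/-- The ideal of `k[X, T]` generated by the elements `X_i T_i - X_o T_o` for `i ∈ R`. -/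
noncomputable def koszulIdeal (k : Type*) [Field k] {n : ℕ} (o : Fin n) (R : Finset (Fin n)) :
    Ideal (MvPolynomial (Fin n) (MvPolynomial (Fin n) k)) :=
  Ideal.span ((fun i => C (X i) * X i - C (X o) * X o) '' R)

theorem koszulIdeal_insert (o i : Fin n) (R : Finset (Fin n)) :
    koszulIdeal k o (insert i R) =
      Ideal.span {C (X i) * X i - C (X o) * X o} ⊔ koszulIdeal k o R := by
  rw [koszulIdeal, Finset.coe_insert, Set.image_insert_eq, Ideal.span_insert, koszulIdeal]

theorem monomial_sub_monomial_mem_koszulIdeal {o : Fin n} {R : Finset (Fin n)}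
    (u b u' b' : Fin n →₀ ℕ) (hb : ∀ l ∉ R, b l = b' l) (hu : ∀ l ∉ R, u l = u' l)
    (hsum : ∑ l ∈ R, b l = ∑ l ∈ R, b' l) (hR : ∀ l ∈ R, u l + b' l = u' l + b l) :
    (monomial b (monomial u (1 : k)) - monomial b' (monomial u' 1)) ∈ koszulIdeal k o R := by
  generalize hN : ∑ l ∈ R, (b l - b' l) = N
  induction N using Nat.strong_induction_on generalizing u b with
  | _ N ih =>
  by_cases hall : ∀ l ∈ R, b l ≤ b' l
  · have heq : ∀ l ∈ R, b l = b' l := (Finset.sum_eq_sum_iff_of_le hall).1 hsum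
    have hb' : b = b' := by
      ext l
      by_cases hl : l ∈ R
      exacts [heq l hl, hb l hl]
    have hu' : u = u' := by
      ext l
      by_cases hl : l ∈ R
      · have := hR l hl
        rw [heq l hl] at this
        omega
      · exact hu l hl
    rw [hb', hu', sub_self]
    exact Submodule.zero_mem _
  · push Not at hall
    obtain ⟨i, hi, hlt⟩ := hall
    obtain ⟨j, hj, hlt'⟩ : ∃ j ∈ R, b j < b' j := by
      by_contra! h
      exact absurd hsum (Finset.sum_lt_sum h ⟨i, hi, hlt⟩).ne'
    have hij : i ≠ j := by rintro rfl; omega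
    have hui : 1 ≤ u i := by have := hR i hi; omega
    obtain ⟨u₀, rfl⟩ : ∃ u₀, u = u₀ + Finsupp.single i 1 :=
      ⟨u - Finsupp.single i 1, (tsub_add_cancel_of_le (by simpa using hui)).symm⟩
    obtain ⟨b₀, rfl⟩ : ∃ b₀, b = b₀ + Finsupp.single i 1 :=
      ⟨b - Finsupp.single i 1, (tsub_add_cancel_of_le (by simp; omega)).symm⟩
    have hstep : monomial (b₀ + Finsupp.single i 1) (monomial (u₀ + Finsupp.single i 1) (1 : k)) -
        monomial (b₀ + Finsupp.single j 1) (monomial (u₀ + Finsupp.single j 1) 1) ∈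
          koszulIdeal k o R := by
      have h1 : ∀ l ∈ R, (C (X l) * X l - C (X o) * X o :
          MvPolynomial (Fin n) (MvPolynomial (Fin n) k)) ∈ koszulIdeal k o R :=
        fun l hl => Ideal.subset_span ⟨l, hl, rfl⟩
      have h2 : ∀ l, monomial (b₀ + Finsupp.single l 1)
          (monomial (u₀ + Finsupp.single l 1) (1 : k)) =
          monomial b₀ (monomial u₀ 1) * (C (X l) * X l) := by
        intro l
        simp [X, C_mul_monomial, monomial_mul]
      rw [h2, h2, ← mul_sub]
      refine Ideal.mul_mem_left _ _ ?_
      have := sub_mem (h1 i hi) (h1 j hj)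
      simpa using this
    have hsi : ∀ l, (Finsupp.single i 1 : Fin n →₀ ℕ) l = if i = l then 1 else 0 :=
      fun l => Finsupp.single_apply
    have hsj : ∀ l, (Finsupp.single j 1 : Fin n →₀ ℕ) l = if j = l then 1 else 0 :=
      fun l => Finsupp.single_apply
    rw [← sub_add_sub_cancel]
    refine add_mem hstep (ih (∑ l ∈ R, ((b₀ + Finsupp.single j 1 : Fin n →₀ ℕ) l - b' l))
      ?_ _ _ ?_ ?_ ?_ ?_
      rfl)
    · rw [← hN]
      refine Finset.sum_lt_sum (fun l hl => ?_) ⟨i, hi, ?_⟩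
      · simp only [Finsupp.add_apply, hsi, hsj] at hlt' ⊢
        by_cases h : j = l
        · subst h
          simp only [if_neg hij, if_true] at hlt' ⊢
          omega
        · simp only [if_neg h]
          omega
      · simp only [Finsupp.add_apply, hsi, hsj, if_neg hij.symm, if_true] at hlt ⊢
        omega
    · intro l hl
      have h1 : i ≠ l := by rintro rfl; exact hl hi
      have h2 : j ≠ l := by rintro rfl; exact hl hj
      simpa [hsi, hsj, h1, h2] using hb l hl
    · intro l hl
      have h1 : i ≠ l := by rintro rfl; exact hl hi
      have h2 : j ≠ l := by rintro rfl; exact hl hj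
      simpa [hsi, hsj, h1, h2] using hu l hl
    · rw [← hsum]
      simp [Finset.sum_add_distrib, hsi, hsj, hi, hj]
    · intro l hl
      have := hR l hl
      simp only [Finsupp.add_apply, hsi, hsj] at this ⊢
      omega

/-- The `X`-exponents of the image of `T_i` in the toric parametrisation of `koszulIdeal`. -/
noncomputable def toricExpX (R : Finset (Fin n)) (i : Fin n) : Fin n →₀ ℕ :=
  if i ∈ R then ∑ j ∈ R.erase i, Finsupp.single j 1 else 0

/-- The `T`-exponents of the image of `T_i` in the toric parametrisation of `koszulIdeal`. -/
noncomputable def toricExpT (o : Fin n) (R : Finset (Fin n)) (i : Fin n) : Fin n →₀ ℕ :=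
  if i ∈ R then Finsupp.single o 1 else Finsupp.single i 1

/-- The toric parametrisation with kernel `koszulIdeal k o R`. -/
noncomputable def toricMap (k : Type*) [Field k] {n : ℕ} (o : Fin n) (R : Finset (Fin n)) :
    MvPolynomial (Fin n) (MvPolynomial (Fin n) k) →ₐ[MvPolynomial (Fin n) k]
      MvPolynomial (Fin n) (MvPolynomial (Fin n) k) :=
  aeval fun i => monomial (toricExpT o R i) (monomial (toricExpX R i) 1)

theorem toricMap_monomial (o : Fin n) (R : Finset (Fin n)) (u b : Fin n →₀ ℕ) (c : k) :
    toricMap k o R (monomial b (monomial u c)) =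
      monomial (∑ i, b i • toricExpT o R i) (monomial (u + ∑ i, b i • toricExpX R i) c) := by
  rw [toricMap, aeval_monomial, Finsupp.prod_fintype _ _ (by simp)]
  simp only [monomial_pow, one_pow]
  rw [← monomial_sum_prod, ← monomial_sum_one, algebraMap_eq, C_mul_monomial, monomial_mul, mul_one]

theorem toricMap_eq_zero_of_mem {o : Fin n} {R : Finset (Fin n)} (ho : o ∈ R)
    {f : MvPolynomial (Fin n) (MvPolynomial (Fin n) k)} (hf : f ∈ koszulIdeal k o R) :
    toricMap k o R f = 0 := by
  suffices h : koszulIdeal k o R ≤ RingHom.ker (toricMap k o R) from h hf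
  rw [koszulIdeal, Ideal.span_le]
  rintro _ ⟨i, hi, rfl⟩
  have h : ∀ l ∈ R, toricMap k o R (C (X l) * X l) =
      monomial (Finsupp.single o 1) (monomial (∑ j ∈ R, Finsupp.single j 1) 1) := by
    intro l hl
    rw [X, X, C_mul_monomial, mul_one, toricMap_monomial]
    congr 2
    · rw [Finset.sum_eq_single l (by intro b _ hb; simp [hb.symm]) (by simp)]
      simp [toricExpT, hl]
    · rw [Finset.sum_eq_single l (by intro b _ hb; simp [hb.symm]) (by simp),
        ← Finset.add_sum_erase _ _ hl]
      simp [toricExpX, hl]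
  simp only [SetLike.mem_coe, RingHom.mem_ker, map_sub]
  rw [h i hi, h o ho, sub_self]

theorem sum_smul_toricExpT_apply {o : Fin n} {R : Finset (Fin n)} (ho : o ∈ R) (b : Fin n →₀ ℕ) :
    (∀ l ∉ R, (∑ i, b i • toricExpT o R i) l = b l) ∧
      (∑ i, b i • toricExpT o R i) o = ∑ i ∈ R, b i := by
  classical
  constructor
  · intro l hl
    have hol : o ≠ l := by rintro rfl; exact hl ho
    rw [Finsupp.finsetSum_apply, Finset.sum_eq_single l]
    · simp [toricExpT, hl]
    · intro i _ hi
      by_cases h : i ∈ R <;> simp [toricExpT, h, hol.symm, hi.symm]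
    · simp
  · rw [Finsupp.finsetSum_apply, ← Finset.sum_subset (Finset.subset_univ R)]
    · refine Finset.sum_congr rfl fun i hi => ?_
      simp [toricExpT, hi]
    · intro i _ hi
      have hio : o ≠ i := by rintro rfl; exact hi ho
      simp [toricExpT, hi, hio]

theorem sum_smul_toricExpX_apply (R : Finset (Fin n)) (b : Fin n →₀ ℕ) :
    (∀ l ∉ R, (∑ i, b i • toricExpX R i) l = 0) ∧
      ∀ l ∈ R, (∑ i, b i • toricExpX R i) l + b l = ∑ i ∈ R, b i := by
  classical
  constructor
  · intro l hl
    rw [Finsupp.finsetSum_apply]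
    refine Finset.sum_eq_zero fun i _ => ?_
    by_cases h : i ∈ R
    · simp [toricExpX, h, Finsupp.single_apply, hl]
    · simp [toricExpX, h]
  · intro l hl
    rw [← Finset.sum_erase_add _ _ hl, Finsupp.finsetSum_apply,
      ← Finset.sum_subset (Finset.subset_univ (R.erase l))]
    · congr 1
      refine Finset.sum_congr rfl fun i hi => ?_
      rw [Finset.mem_erase] at hi
      simp [toricExpX, hi.2, Finsupp.single_apply, hl, hi.1.symm]
    · intro i _ hi
      by_cases h : i ∈ R
      · have : i = l := by simpa [h] using hi
        subst this
        simp [toricExpX, h, Finsupp.single_apply]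
      · simp [toricExpX, h]

theorem mem_koszulIdeal_iff {o : Fin n} {R : Finset (Fin n)} (ho : o ∈ R)
    (f : MvPolynomial (Fin n) (MvPolynomial (Fin n) k)) :
    f ∈ koszulIdeal k o R ↔ toricMap k o R f = 0 := by
  classical
  refine ⟨toricMap_eq_zero_of_mem ho, fun hf => ?_⟩
  let B := (basisMonomials (Fin n) k).smulTower (basisMonomials (Fin n) (MvPolynomial (Fin n) k))
  have hB : ∀ u b, B (u, b) = monomial b (monomial u 1) := by
    intro u b
    simp [B, Module.Basis.smulTower_apply, smul_monomial]
  let g : (Fin n →₀ ℕ) × (Fin n →₀ ℕ) → (Fin n →₀ ℕ) × (Fin n →₀ ℕ) := fun x =>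
    (x.1 + ∑ i, x.2 i • toricExpX R i, ∑ i, x.2 i • toricExpT o R i)
  let sec : MvPolynomial (Fin n) (MvPolynomial (Fin n) k) →ₗ[k]
      MvPolynomial (Fin n) (MvPolynomial (Fin n) k) :=
    B.constr k fun y => B (Function.invFun g y)
  have key : ((koszulIdeal k o R).restrictScalars k).mkQ ∘ₗ
      (sec ∘ₗ ((toricMap k o R).toLinearMap.restrictScalars k)) =
      ((koszulIdeal k o R).restrictScalars k).mkQ := by
    refine B.ext fun ⟨u, b⟩ => ?_
    obtain ⟨⟨u', b'⟩, hub⟩ : ∃ y, Function.invFun g (g (u, b)) = y := ⟨_, rfl⟩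
    have hg : g (u', b') = g (u, b) := by
      rw [← hub]
      exact Function.invFun_eq ⟨_, rfl⟩
    have h1 : toricMap k o R (B (u, b)) = B (g (u, b)) := by
      rw [hB, toricMap_monomial, hB]
    have h2 : sec (B (g (u, b))) = B (u', b') := by
      rw [Module.Basis.constr_basis, hub]
    simp only [LinearMap.comp_apply, LinearMap.restrictScalars_apply, AlgHom.toLinearMap_apply]
    rw [h1, h2, ← sub_eq_zero, ← map_sub, Submodule.mkQ_apply, Submodule.Quotient.mk_eq_zero,
      Submodule.restrictScalars_mem, hB, hB]
    simp only [g, Prod.mk.injEq] at hg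
    obtain ⟨hg1, hg2⟩ := hg
    have hsum : ∑ i ∈ R, b' i = ∑ i ∈ R, b i := by
      rw [← (sum_smul_toricExpT_apply ho b').2, hg2, (sum_smul_toricExpT_apply ho b).2]
    refine monomial_sub_monomial_mem_koszulIdeal _ _ _ _ (fun l hl => ?_) (fun l hl => ?_) hsum
      fun l hl => ?_
    · rw [← (sum_smul_toricExpT_apply ho b').1 l hl, hg2, (sum_smul_toricExpT_apply ho b).1 l hl]
    · have := DFunLike.congr_fun hg1 l
      rw [Finsupp.add_apply, Finsupp.add_apply, (sum_smul_toricExpX_apply R b').1 l hl,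
        (sum_smul_toricExpX_apply R b).1 l hl] at this
      exact this
    · have := DFunLike.congr_fun hg1 l
      rw [Finsupp.add_apply, Finsupp.add_apply] at this
      have h1 := (sum_smul_toricExpX_apply R b').2 l hl
      have h2 := (sum_smul_toricExpX_apply R b).2 l hl
      omega
  have h := LinearMap.congr_fun key f
  simp only [LinearMap.comp_apply, LinearMap.restrictScalars_apply, AlgHom.toLinearMap_apply, hf,
    map_zero] at h
  rw [eq_comm, Submodule.mkQ_apply, Submodule.Quotient.mk_eq_zero,
    Submodule.restrictScalars_mem] at h
  exact h

theorem mem_koszulIdeal_of_mul_mem {o i : Fin n} {R : Finset (Fin n)} (ho : o ∈ R) (hi : i ∉ R)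
    {f : MvPolynomial (Fin n) (MvPolynomial (Fin n) k)}
    (hf : (C (X i) * X i - C (X o) * X o) * f ∈ koszulIdeal k o R) : f ∈ koszulIdeal k o R := by
  classical
  rw [mem_koszulIdeal_iff ho] at hf ⊢
  rw [map_mul, mul_eq_zero] at hf
  refine hf.resolve_left fun h => ?_
  have hoi : o ≠ i := by rintro rfl; exact hi ho
  have h' := congrArg (coeff (Finsupp.single i 1)) h
  simp [toricMap, toricExpT, toricExpX, hi, ho, coeff_C_mul, coeff_monomial,
    Finsupp.single_left_inj, hoi, X_ne_zero] at h'

end KoszulIdeal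

section KoszulResolution

variable {k : Type*} [Field k] {n : ℕ}

/-- The identification of a free module with `k[X, T]` given by indexing the basis by the
monomials in the variables `T`. -/
noncomputable def toPolynomial {ι : Type*} (e : ι ≃ (Fin n →₀ ℕ)) :
    (ι →₀ MvPolynomial (Fin n) k) ≃ₗ[MvPolynomial (Fin n) k]
      MvPolynomial (Fin n) (MvPolynomial (Fin n) k) :=
  (Finsupp.domLCongr e).trans (basisMonomials (Fin n) (MvPolynomial (Fin n) k)).repr.symm

theorem toPolynomial_single {ι : Type*} (e : ι ≃ (Fin n →₀ ℕ)) (x : ι)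
    (c : MvPolynomial (Fin n) k) : toPolynomial e (Finsupp.single x c) = monomial (e x) c := by
  simp [toPolynomial, smul_monomial]

/-- The Koszul complex over `k[X, T]` on the elements `X_i T_i - X_o T_o` for `i ∈ R`, `i ≠ o`,
as a complex of free `k[X]`-modules. The basis of the `p`-th term is indexed by `ι p`; the maps
`T p i` give the action of the variable `T_i`; `τ` and `ω` are the degree in the variables `T` and
the weight, where `X_i` has weight `w i` and `T_i` has weight `W - w i`. -/
structure KoszulRes (k : Type*) [Field k] {n : ℕ} (w : Fin n → ℕ) (W : ℕ) (o : Fin n)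
    (R : Finset (Fin n)) where
  ι : ℕ → Type
  τ : ∀ p, ι p → ℕ
  ω : ∀ p, ι p → ℕ
  T : ∀ p, Fin n → ι p → ι p
  d : ∀ p, (ι (p + 1) →₀ MvPolynomial (Fin n) k) →ₗ[MvPolynomial (Fin n) k]
    (ι p →₀ MvPolynomial (Fin n) k)
  e : ι 0 ≃ (Fin n →₀ ℕ)
  e_T : ∀ i x, e (T 0 i x) = e x + Finsupp.single i 1
  τ_zero : ∀ x, τ 0 x = ∑ i, e x i
  ω_zero : ∀ x, ω 0 x = ∑ i, e x i * (W - w i)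
  τ_T : ∀ p i x, τ p (T p i x) = τ p x + 1
  ω_T : ∀ p i x, ω p (T p i x) + w i = ω p x + W
  d_T : ∀ p i f, d p (Finsupp.lmapDomain _ (MvPolynomial (Fin n) k) (T (p + 1) i) f) =
    Finsupp.lmapDomain _ (MvPolynomial (Fin n) k) (T p i) (d p f)
  T_comm : ∀ p i j x, T p i (T p j x) = T p j (T p i x)
  exact : ∀ p, LinearMap.ker (d p) = LinearMap.range (d (p + 1))
  mem_range : ∀ f, f ∈ LinearMap.range (d 0) ↔ toPolynomial e f ∈ koszulIdeal k o R
  min : ∀ p f q, constantCoeff (d p f q) = 0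
  graded_τ : ∀ p, IsGradedMap 0 (τ (p + 1)) (τ p) (d p)
  graded_ω : ∀ p, IsGradedMap w (ω (p + 1)) (ω p) (d p)
  le_τ : ∀ p x, p ≤ τ p x
  lt_card : ∀ p (_ : ι p), p < R.card
  ω_le : ∀ p x, ω p x + (τ p x - p) * w o ≤ τ p x * W
  exists_ω_eq : ∀ p s, p < R.card → p ≤ s → ∃ x, τ p x = s ∧ ω p x + (s - p) * w o = s * W

/-- The Koszul complex on the empty sequence. -/
noncomputable def KoszulRes.base (k : Type*) [Field k] {n : ℕ} (w : Fin n → ℕ) (W : ℕ)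
    (hW : ∀ i, w i ≤ W) (o : Fin n) (ho : ∀ i, w o ≤ w i) : KoszulRes k w W o {o} where
  ι p := match p with
    | 0 => Fin n →₀ ℕ
    | _ + 1 => Empty
  τ p := match p with
    | 0 => fun x => ∑ i, x i
    | _ + 1 => Empty.elim
  ω p := match p with
    | 0 => fun x => ∑ i, x i * (W - w i)
    | _ + 1 => Empty.elim
  T p i := match p with
    | 0 => fun x => x + Finsupp.single i 1
    | _ + 1 => Empty.elim
  d _ := 0
  e := Equiv.refl _
  e_T _ _ := rfl
  τ_zero _ := rfl
  ω_zero _ := rfl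
  τ_T p i x := match p, x with
    | 0, x => by simp [Finset.sum_add_distrib, Finsupp.single_apply]
  ω_T p i x := match p, x with
    | 0, x => by
      have := hW i
      simp only [Finsupp.add_apply, Finsupp.single_apply, add_mul, Finset.sum_add_distrib, ite_mul,
        one_mul, zero_mul, Finset.sum_ite_eq, Finset.mem_univ, if_true]
      omega
  d_T _ _ _ := by simp
  T_comm p i j x := match p, x with
    | 0, x => add_right_comm x _ _
  exact p := by
    rw [LinearMap.ker_zero, LinearMap.range_zero, eq_comm, Submodule.eq_top_iff']
    intro f
    rw [Submodule.mem_bot]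
    ext q : 1
    exact q.elim
  mem_range f := by
    rw [koszulIdeal, Finset.coe_singleton, Set.image_singleton, sub_self, Ideal.span_singleton_zero]
    rw [LinearMap.range_zero, Submodule.mem_bot, Ideal.mem_bot]
    exact (LinearEquiv.map_eq_zero_iff _).symm
  min _ _ _ := by simp
  graded_τ _ _ _ _ := isHomog_zero _ _ _
  graded_ω _ _ _ _ := isHomog_zero _ _ _
  le_τ p x := match p, x with
    | 0, x => Nat.zero_le _
  lt_card p x := match p, x with
    | 0, x => by simp
  ω_le p x := match p, x with
    | 0, x => by
      rw [Nat.sub_zero, Finset.sum_mul, Finset.sum_mul, ← Finset.sum_add_distrib]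
      refine Finset.sum_le_sum fun i _ => ?_
      rw [← mul_add]
      have := hW i
      have := ho i
      exact Nat.mul_le_mul_left _ (by omega)
  exists_ω_eq p s hp hs := by
    obtain rfl : p = 0 := by simpa using hp
    refine ⟨Finsupp.single o s, by simp [Finsupp.single_apply], ?_⟩
    have := hW o
    simp only [Finsupp.single_apply, ite_mul, zero_mul, Finset.sum_ite_eq, Finset.mem_univ,
      if_true, Nat.sub_zero, ← mul_add]
    congr 1
    omega

section Sum

variable {σ α β : Type*}

theorem IsGradedMap.add_right {w : σ → ℕ} {a : α → ℕ} {b : β → ℕ}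
    {L : (α →₀ MvPolynomial σ k) →ₗ[MvPolynomial σ k] (β →₀ MvPolynomial σ k)}
    (hL : IsGradedMap w a b L) (c : ℕ) :
    IsGradedMap w (fun x => a x + c) (fun x => b x + c) L := by
  refine isGradedMap_of_single fun q p u hu => ?_
  have := hL _ _ (isHomog_single_one w a q) p u hu
  omega

end Sum

namespace KoszulRes

variable {w : Fin n → ℕ} {W : ℕ} {o : Fin n} {R : Finset (Fin n)} (K : KoszulRes k w W o R)

/-- Multiplication by `X_i T_i - X_o T_o` on the Koszul complex. -/
noncomputable def mulMap (i : Fin n) (p : ℕ) :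
    (K.ι p →₀ MvPolynomial (Fin n) k) →ₗ[MvPolynomial (Fin n) k]
      (K.ι p →₀ MvPolynomial (Fin n) k) :=
  (X i : MvPolynomial (Fin n) k) • Finsupp.lmapDomain _ _ (K.T p i) -
    (X o : MvPolynomial (Fin n) k) • Finsupp.lmapDomain _ _ (K.T p o)

theorem d_mulMap (i : Fin n) (p : ℕ) (f : K.ι (p + 1) →₀ MvPolynomial (Fin n) k) :
    K.d p (K.mulMap i (p + 1) f) = K.mulMap i p (K.d p f) := by
  simp only [mulMap, LinearMap.sub_apply, LinearMap.smul_apply, map_sub, map_smul, K.d_T]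

theorem mulMap_single (i : Fin n) (p : ℕ) (x : K.ι p) :
    K.mulMap i p (Finsupp.single x 1) =
      Finsupp.single (K.T p i x) (X i) - Finsupp.single (K.T p o x) (X o) := by
  simp [mulMap]

theorem toPolynomial_mulMap (i : Fin n) (f : K.ι 0 →₀ MvPolynomial (Fin n) k) :
    toPolynomial K.e (K.mulMap i 0 f) =
      (C (X i) * X i - C (X o) * X o) * toPolynomial K.e f := by
  induction f using Finsupp.induction_linear with
  | zero => simp
  | add f g hf hg => rw [map_add, map_add, map_add, mul_add, hf, hg]
  | single x c =>
    simp only [mulMap, LinearMap.sub_apply, LinearMap.smul_apply, Finsupp.lmapDomain_apply,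
      Finsupp.mapDomain_single, Finsupp.smul_single, map_sub, toPolynomial_single, K.e_T,
      smul_eq_mul]
    have h : ∀ l : Fin n, C (X l) * X l * monomial (K.e x) c =
        monomial (K.e x + Finsupp.single l 1) (X l * c : MvPolynomial (Fin n) k) := by
      intro l
      rw [show (X l : MvPolynomial (Fin n) (MvPolynomial (Fin n) k)) =
        monomial (Finsupp.single l 1) 1 from rfl, C_mul_monomial, monomial_mul, mul_one, add_comm]
    rw [sub_mul, h, h]

theorem constantCoeff_mulMap (i : Fin n) (p : ℕ) (f : K.ι p →₀ MvPolynomial (Fin n) k)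
    (q : K.ι p) : constantCoeff (K.mulMap i p f q) = 0 := by
  simp [mulMap]

theorem isGradedMap_mulMap {p : ℕ} {v : Fin n → ℕ} {a : K.ι p → ℕ} {c : ℕ}
    (ha : ∀ i x, a (K.T p i x) + v i = a x + c) (i : Fin n) :
    IsGradedMap v (fun x => a x + c) a (K.mulMap i p) := by
  refine isGradedMap_of_single fun q => ?_
  rw [mulMap_single, sub_eq_add_neg]
  have h : ∀ l, IsHomog v a (a q + c)
      (Finsupp.single (K.T p l q) (X l : MvPolynomial (Fin n) k)) := by
    intro l
    have := isHomog_single_monomial (k := k) v a (K.T p l q) (Finsupp.single l 1) 1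
    rw [Finsupp.weight_single, one_smul, add_comm, ha] at this
    exact this
  exact (h i).add (h o).neg

/-- The basis of the mapping cone. -/
def coneι (ι : ℕ → Type) : ℕ → Type
  | 0 => ι 0
  | p + 1 => ι (p + 1) ⊕ ι p

/-- Degrees on the mapping cone of a map that raises degrees by `c`. -/
def coneDeg {ι : ℕ → Type} (a : ∀ p, ι p → ℕ) (c : ℕ) : ∀ p, coneι ι p → ℕ
  | 0 => a 0
  | p + 1 => Sum.elim (a (p + 1)) fun x => a p x + c

/-- The action of the variable `T_i` on the mapping cone. -/
def coneT (i : Fin n) : ∀ p, coneι K.ι p → coneι K.ι p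
  | 0 => K.T 0 i
  | p + 1 => Sum.map (K.T (p + 1) i) (K.T p i)

/-- Splitting a term of the mapping cone. -/
noncomputable def conePair (p : ℕ) : (coneι K.ι (p + 1) →₀ MvPolynomial (Fin n) k)
    ≃ₗ[MvPolynomial (Fin n) k]
      (K.ι (p + 1) →₀ MvPolynomial (Fin n) k) × (K.ι p →₀ MvPolynomial (Fin n) k) :=
  Finsupp.sumFinsuppLEquivProdFinsupp (MvPolynomial (Fin n) k)

/-- The differential of the mapping cone of `mulMap`. -/
noncomputable def coneD (i : Fin n) :
    ∀ p, (coneι K.ι (p + 1) →₀ MvPolynomial (Fin n) k) →ₗ[MvPolynomial (Fin n) k]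
      (coneι K.ι p →₀ MvPolynomial (Fin n) k)
  | 0 => (K.d 0).coprod (K.mulMap i 0) ∘ₗ (K.conePair 0).toLinearMap
  | p + 1 => (K.conePair p).symm.toLinearMap ∘ₗ
      ((K.d (p + 1)).coprod (K.mulMap i (p + 1))).prod
        (-(K.d p ∘ₗ LinearMap.snd (MvPolynomial (Fin n) k) _ _)) ∘ₗ
      (K.conePair (p + 1)).toLinearMap

theorem coneD_zero_apply (i : Fin n) (x : coneι K.ι 1 →₀ MvPolynomial (Fin n) k) :
    K.coneD i 0 x = K.d 0 (K.conePair 0 x).1 + K.mulMap i 0 (K.conePair 0 x).2 :=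
  rfl

theorem conePair_coneD (i : Fin n) (p : ℕ) (x : coneι K.ι (p + 2) →₀ MvPolynomial (Fin n) k) :
    K.conePair p (K.coneD i (p + 1) x) =
      (K.d (p + 1) (K.conePair (p + 1) x).1 + K.mulMap i (p + 1) (K.conePair (p + 1) x).2,
        -K.d p (K.conePair (p + 1) x).2) :=
  (K.conePair p).apply_symm_apply _

theorem conePair_apply_fst (p : ℕ) (x : coneι K.ι (p + 1) →₀ MvPolynomial (Fin n) k)
    (q : K.ι (p + 1)) : (K.conePair p x).1 q = x (Sum.inl q) :=
  rfl

theorem conePair_apply_snd (p : ℕ) (x : coneι K.ι (p + 1) →₀ MvPolynomial (Fin n) k)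
    (q : K.ι p) : (K.conePair p x).2 q = x (Sum.inr q) :=
  rfl

theorem d_d (p : ℕ) (f : K.ι (p + 2) →₀ MvPolynomial (Fin n) k) : K.d p (K.d (p + 1) f) = 0 := by
  have : K.d (p + 1) f ∈ LinearMap.ker (K.d p) := K.exact p ▸ ⟨f, rfl⟩
  exact this

theorem cone_exact (ho : o ∈ R) {i : Fin n} (hi : i ∉ R) (p : ℕ) :
    LinearMap.ker (K.coneD i p) = LinearMap.range (K.coneD i (p + 1)) := by
  ext x
  have hexact : ∀ p f, K.d p f = 0 → ∃ g, K.d (p + 1) g = f := fun p f hf =>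
    (K.exact p ▸ (LinearMap.mem_ker.2 hf : f ∈ LinearMap.ker (K.d p)) :
      f ∈ LinearMap.range (K.d (p + 1)))
  constructor
  · intro h
    replace h := LinearMap.mem_ker.1 h
    suffices hb : ∃ c, K.d p c = (K.conePair p x).2 ∧
        K.d p (K.conePair p x).1 + K.mulMap i p (K.conePair p x).2 = 0 by
      obtain ⟨c, hc, h⟩ := hb
      rw [← hc, ← d_mulMap, ← map_add] at h
      obtain ⟨e, he⟩ := hexact p _ h
      refine ⟨(K.conePair (p + 1)).symm (e, -c), (K.conePair p).injective ?_⟩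
      rw [conePair_coneD, LinearEquiv.apply_symm_apply, he, map_neg, map_neg, neg_neg,
        add_neg_cancel_right, hc]
    cases p with
    | zero =>
      rw [coneD_zero_apply] at h
      suffices hb : (K.conePair 0 x).2 ∈ LinearMap.range (K.d 0) by
        obtain ⟨c, hc⟩ := hb
        exact ⟨c, hc, h⟩
      have h' : K.mulMap i 0 (K.conePair 0 x).2 ∈ LinearMap.range (K.d 0) :=
        ⟨-(K.conePair 0 x).1, by
          rw [map_neg, neg_eq_iff_add_eq_zero]
          exact h⟩
      rw [K.mem_range, toPolynomial_mulMap] at h'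
      rw [K.mem_range]
      exact mem_koszulIdeal_of_mul_mem ho hi h'
    | succ p =>
      have h' := K.conePair_coneD i p x
      rw [h, map_zero, eq_comm, Prod.mk_eq_zero, neg_eq_zero] at h'
      obtain ⟨c, hc⟩ := hexact p _ h'.2
      exact ⟨c, hc, h'.1⟩
  · rintro ⟨y, rfl⟩
    rw [LinearMap.mem_ker]
    cases p with
    | zero =>
      rw [coneD_zero_apply, conePair_coneD, map_add, d_d, d_mulMap, map_neg, zero_add,
        add_neg_cancel]
      rfl
    | succ p =>
      apply (K.conePair p).injective
      rw [conePair_coneD, conePair_coneD, map_add, d_d, d_mulMap, map_neg, map_neg, zero_add,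
        add_neg_cancel, d_d, neg_zero, neg_zero, map_zero]
      rfl

theorem isHomog_cone_iff {v : Fin n → ℕ} {a : ∀ p, K.ι p → ℕ} {c D p : ℕ}
    (x : coneι K.ι (p + 1) →₀ MvPolynomial (Fin n) k) :
    IsHomog v (coneDeg a c (p + 1)) D x ↔ IsHomog v (a (p + 1)) D (K.conePair p x).1 ∧
      IsHomog v (fun q => a p q + c) D (K.conePair p x).2 :=
  ⟨fun h => ⟨fun q u hu => h (Sum.inl q) u hu, fun q u hu => h (Sum.inr q) u hu⟩,
    fun h => Sum.rec (fun q u hu => h.1 q u hu) fun q u hu => h.2 q u hu⟩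

theorem cone_graded {v : Fin n → ℕ} {a : ∀ p, K.ι p → ℕ} {c : ℕ}
    (hT : ∀ p i x, a p (K.T p i x) + v i = a p x + c)
    (hd : ∀ p, IsGradedMap v (a (p + 1)) (a p) (K.d p)) (i : Fin n) (p : ℕ) :
    IsGradedMap v (coneDeg a c (p + 1)) (coneDeg a c p) (K.coneD i p) := by
  intro D x hx
  obtain ⟨hx₁, hx₂⟩ := (K.isHomog_cone_iff x).1 hx
  have h1 := (hd p _ _ hx₁).add (K.isGradedMap_mulMap (hT p) i _ _ hx₂)
  cases p with
  | zero => exact h1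
  | succ p =>
    rw [isHomog_cone_iff, conePair_coneD]
    exact ⟨h1, ((hd p).add_right c _ _ hx₂).neg⟩

theorem conePair_single_inl (p : ℕ) (q : K.ι (p + 1)) (c : MvPolynomial (Fin n) k) :
    K.conePair p (Finsupp.single (Sum.inl q) c) = (Finsupp.single q c, 0) := by
  refine Prod.ext (Finsupp.ext fun r => ?_) (Finsupp.ext fun r => ?_)
  · rw [conePair_apply_fst]
    exact Finsupp.single_apply_left Sum.inl_injective q r c
  · rw [conePair_apply_snd]
    exact Finsupp.single_eq_of_ne Sum.inr_ne_inl

theorem conePair_single_inr (p : ℕ) (q : K.ι p) (c : MvPolynomial (Fin n) k) :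
    K.conePair p (Finsupp.single (Sum.inr q) c) = (0, Finsupp.single q c) := by
  refine Prod.ext (Finsupp.ext fun r => ?_) (Finsupp.ext fun r => ?_)
  · rw [conePair_apply_fst]
    exact Finsupp.single_eq_of_ne Sum.inl_ne_inr
  · rw [conePair_apply_snd]
    exact Finsupp.single_apply_left Sum.inr_injective q r c

theorem conePair_coneT (i : Fin n) (p : ℕ) (x : coneι K.ι (p + 1) →₀ MvPolynomial (Fin n) k) :
    K.conePair p (Finsupp.lmapDomain _ (MvPolynomial (Fin n) k) (K.coneT i (p + 1)) x) =
      (Finsupp.lmapDomain _ (MvPolynomial (Fin n) k) (K.T (p + 1) i) (K.conePair p x).1,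
        Finsupp.lmapDomain _ (MvPolynomial (Fin n) k) (K.T p i) (K.conePair p x).2) := by
  induction x using Finsupp.induction_linear with
  | zero =>
    simp only [map_zero, Prod.fst_zero, Prod.snd_zero]
    rfl
  | add f g hf hg => simp only [map_add, hf, hg, Prod.mk_add_mk, Prod.fst_add, Prod.snd_add]
  | single q c =>
    rw [Finsupp.lmapDomain_apply, Finsupp.mapDomain_single]
    cases q with
    | inl q =>
      rw [conePair_single_inl]
      simp only [Finsupp.lmapDomain_apply, Finsupp.mapDomain_single, map_zero]
      exact K.conePair_single_inl p _ c
    | inr q =>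
      rw [conePair_single_inr]
      simp only [Finsupp.lmapDomain_apply, Finsupp.mapDomain_single, map_zero]
      exact K.conePair_single_inr p _ c

theorem lmapDomain_T_mulMap (i j : Fin n) (p : ℕ) (f : K.ι p →₀ MvPolynomial (Fin n) k) :
    Finsupp.lmapDomain _ (MvPolynomial (Fin n) k) (K.T p j) (K.mulMap i p f) =
      K.mulMap i p (Finsupp.lmapDomain _ (MvPolynomial (Fin n) k) (K.T p j) f) := by
  have h : ∀ l, K.T p j ∘ K.T p l = K.T p l ∘ K.T p j := fun l =>
    funext fun x => K.T_comm p j l x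
  simp only [mulMap, LinearMap.sub_apply, LinearMap.smul_apply, map_sub, map_smul,
    Finsupp.lmapDomain_apply, ← Finsupp.mapDomain_comp, h]

theorem mem_range_coneD_zero (i : Fin n) (f : K.ι 0 →₀ MvPolynomial (Fin n) k) :
    f ∈ LinearMap.range (K.coneD i 0) ↔ toPolynomial K.e f ∈ koszulIdeal k o (insert i R) := by
  rw [koszulIdeal_insert, Ideal.mem_span_singleton_sup]
  constructor
  · rintro ⟨x, rfl⟩
    refine ⟨toPolynomial K.e (K.conePair 0 x).2, toPolynomial K.e (K.d 0 (K.conePair 0 x).1),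
      (K.mem_range _).1 ⟨_, rfl⟩, ?_⟩
    rw [coneD_zero_apply, map_add, toPolynomial_mulMap]
    ring
  · rintro ⟨a, b, hb, h⟩
    obtain ⟨a, rfl⟩ := (toPolynomial K.e).surjective a
    obtain ⟨b, rfl⟩ := (toPolynomial K.e).surjective b
    obtain ⟨b, rfl⟩ := (K.mem_range _).2 hb
    refine ⟨(K.conePair 0).symm (b, a), (toPolynomial K.e).injective ?_⟩
    rw [← h, coneD_zero_apply, LinearEquiv.apply_symm_apply, map_add, toPolynomial_mulMap]
    ring

/-- The Koszul complex on one more element. -/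
noncomputable def cone (ho : o ∈ R) {i : Fin n} (hi : i ∉ R) :
    KoszulRes k w W o (insert i R) where
  ι := coneι K.ι
  τ := coneDeg K.τ 1
  ω := coneDeg K.ω W
  T p j := K.coneT j p
  d := K.coneD i
  e := K.e
  e_T := K.e_T
  τ_zero := K.τ_zero
  ω_zero := K.ω_zero
  τ_T p j x := match p, x with
    | 0, x => K.τ_T 0 j x
    | p + 1, Sum.inl x => K.τ_T (p + 1) j x
    | p + 1, Sum.inr x => congrArg (· + 1) (K.τ_T p j x)
  ω_T p j x := match p, x with
    | 0, x => K.ω_T 0 j x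
    | p + 1, Sum.inl x => K.ω_T (p + 1) j x
    | p + 1, Sum.inr x => by
      have := K.ω_T p j x
      change K.ω p (K.T p j x) + W + w j = K.ω p x + W + W
      omega
  d_T p j f := by
    cases p with
    | zero =>
      rw [coneD_zero_apply, coneD_zero_apply, conePair_coneT, K.d_T, ← lmapDomain_T_mulMap,
        ← map_add]
      rfl
    | succ p =>
      apply (K.conePair p).injective
      rw [conePair_coneT, conePair_coneD, conePair_coneD, conePair_coneT, K.d_T, K.d_T,
        ← lmapDomain_T_mulMap, ← map_add, ← map_neg]
  T_comm p j l x := match p, x with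
    | 0, x => K.T_comm 0 j l x
    | p + 1, Sum.inl x => congrArg Sum.inl (K.T_comm (p + 1) j l x)
    | p + 1, Sum.inr x => congrArg Sum.inr (K.T_comm p j l x)
  exact := K.cone_exact ho hi
  mem_range := K.mem_range_coneD_zero i
  min p f q := by
    have h : ∀ p f q, constantCoeff ((K.d p (K.conePair p f).1 +
        K.mulMap i p (K.conePair p f).2 : K.ι p →₀ MvPolynomial (Fin n) k) q) = 0 := by
      intro p f q
      rw [Finsupp.add_apply, map_add, K.min, constantCoeff_mulMap, add_zero]
    match p, q with
    | 0, q => exact h 0 f q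
    | p + 1, Sum.inl q =>
      rw [← conePair_apply_fst, conePair_coneD]
      exact h (p + 1) f q
    | p + 1, Sum.inr q =>
      rw [← conePair_apply_snd, conePair_coneD]
      simp only [Finsupp.neg_apply, map_neg, K.min, neg_zero]
  graded_τ := K.cone_graded (fun p j x => K.τ_T p j x) K.graded_τ i
  graded_ω := K.cone_graded K.ω_T K.graded_ω i
  le_τ p x := match p, x with
    | 0, x => Nat.zero_le _
    | p + 1, Sum.inl x => K.le_τ (p + 1) x
    | p + 1, Sum.inr x => Nat.add_le_add_right (K.le_τ p x) 1
  lt_card p x := by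
    rw [Finset.card_insert_of_notMem hi]
    exact match p, x with
    | 0, x => Nat.lt_succ_of_lt (K.lt_card 0 x)
    | p + 1, Sum.inl x => Nat.lt_succ_of_lt (K.lt_card (p + 1) x)
    | p + 1, Sum.inr x => Nat.succ_lt_succ (K.lt_card p x)
  ω_le p x := match p, x with
    | 0, x => K.ω_le 0 x
    | p + 1, Sum.inl x => K.ω_le (p + 1) x
    | p + 1, Sum.inr x => by
      have := K.ω_le p x
      change K.ω p x + W + (K.τ p x + 1 - (p + 1)) * w o ≤ (K.τ p x + 1) * W
      rw [Nat.add_sub_add_right, add_mul, one_mul]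
      omega
  exists_ω_eq p s hp hs := by
    rw [Finset.card_insert_of_notMem hi] at hp
    cases p with
    | zero => exact K.exists_ω_eq 0 s (Finset.card_pos.2 ⟨o, ho⟩) hs
    | succ p =>
      obtain ⟨s, rfl⟩ : ∃ t, s = t + 1 := ⟨s - 1, by omega⟩
      obtain ⟨x, hx, hx'⟩ := K.exists_ω_eq p s (by omega) (by omega)
      refine ⟨Sum.inr x, congrArg (· + 1) hx, ?_⟩
      change K.ω p x + W + (s + 1 - (p + 1)) * w o = (s + 1) * W
      rw [Nat.add_sub_add_right, add_mul, one_mul]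
      omega

end KoszulRes

theorem nonempty_koszulRes (k : Type*) [Field k] {w : Fin n → ℕ} {W : ℕ} (hW : ∀ i, w i ≤ W)
    {o : Fin n} (ho : ∀ i, w o ≤ w i) : Nonempty (KoszulRes k w W o Finset.univ) := by
  suffices h : ∀ R : Finset (Fin n), Nonempty (KoszulRes k w W o (insert o R)) by
    simpa using h Finset.univ
  intro R
  induction R using Finset.induction_on with
  | empty => exact ⟨KoszulRes.base k w W hW o ho⟩
  | insert i R hi h =>
    by_cases hio : i ∈ insert o R
    · rwa [Finset.insert_comm, Finset.insert_eq_of_mem hio]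
    · rw [Finset.insert_comm]
      exact h.map fun K => K.cone (Finset.mem_insert_self o R) hio

end KoszulResolution

section Strand

variable {k : Type*} [Field k] {σ : Type*} {ι κ : Type*}

theorem isHomog_zero_iff {τ : ι → ℕ} {s : ℕ} {f : ι →₀ MvPolynomial σ k} :
    IsHomog 0 τ s f ↔ ∀ q, f q ≠ 0 → τ q = s := by
  constructor
  · intro h q hq
    obtain ⟨u, hu⟩ := MvPolynomial.ne_zero_iff.1 hq
    simpa [Finsupp.weight_apply] using h q u hu
  · intro h q u hu
    have := h q fun h0 => hu (by rw [h0, coeff_zero])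
    simpa [Finsupp.weight_apply] using this

/-- Extension by zero from the basis elements of degree `s`. -/
noncomputable def strandExt (k : Type*) [Field k] (σ : Type*) (τ : ι → ℕ) (s : ℕ) :
    ({x // τ x = s} →₀ MvPolynomial σ k) →ₗ[MvPolynomial σ k] (ι →₀ MvPolynomial σ k) :=
  Finsupp.lmapDomain _ _ Subtype.val

/-- Restriction to the basis elements of degree `s`. -/
noncomputable def strandRes (k : Type*) [Field k] (σ : Type*) (τ : ι → ℕ) (s : ℕ) :
    (ι →₀ MvPolynomial σ k) →ₗ[MvPolynomial σ k] ({x // τ x = s} →₀ MvPolynomial σ k) :=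
  Finsupp.lcomapDomain Subtype.val Subtype.val_injective

theorem strandExt_apply (τ : ι → ℕ) (s : ℕ) (f : {x // τ x = s} →₀ MvPolynomial σ k)
    (x : {x // τ x = s}) : strandExt k σ τ s f x = f x :=
  Finsupp.mapDomain_apply Subtype.val_injective f x

theorem strandExt_apply_of_ne (τ : ι → ℕ) (s : ℕ) (f : {x // τ x = s} →₀ MvPolynomial σ k)
    {x : ι} (hx : τ x ≠ s) : strandExt k σ τ s f x = 0 :=
  Finsupp.mapDomain_of_notMem_range f x fun ⟨y, hy⟩ => hx (hy ▸ y.2)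

theorem strandRes_strandExt (τ : ι → ℕ) (s : ℕ) (f : {x // τ x = s} →₀ MvPolynomial σ k) :
    strandRes k σ τ s (strandExt k σ τ s f) = f :=
  Finsupp.ext fun x => strandExt_apply τ s f x

theorem isHomog_strandExt (τ : ι → ℕ) (s : ℕ) (f : {x // τ x = s} →₀ MvPolynomial σ k) :
    IsHomog 0 τ s (strandExt k σ τ s f) :=
  isHomog_zero_iff.2 fun _ hq => by_contra fun h => hq (strandExt_apply_of_ne τ s f h)

theorem IsHomog.strandExt_strandRes {τ : ι → ℕ} {s : ℕ} {f : ι →₀ MvPolynomial σ k}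
    (hf : IsHomog 0 τ s f) : strandExt k σ τ s (strandRes k σ τ s f) = f := by
  ext1 x
  by_cases hx : τ x = s
  · exact strandExt_apply τ s _ ⟨x, hx⟩
  · rw [strandExt_apply_of_ne τ s _ hx]
    exact (by_contra fun h => hx (isHomog_zero_iff.1 hf x (Ne.symm h)))

theorem IsHomog.strandExt {w : σ → ℕ} {a : ι → ℕ} {D : ℕ} {τ : ι → ℕ} {s : ℕ}
    {f : {x // τ x = s} →₀ MvPolynomial σ k} (hf : IsHomog w (fun x => a x.1) D f) :
    IsHomog w a D (strandExt k σ τ s f) := by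
  intro q u hu
  by_cases hq : τ q = s
  · rw [strandExt_apply τ s f ⟨q, hq⟩] at hu
    exact hf ⟨q, hq⟩ u hu
  · simp [strandExt_apply_of_ne τ s f hq] at hu

/-- The restriction of a map to the basis elements of degree `s`. -/
noncomputable def strandMap (τ : ι → ℕ) (τ' : κ → ℕ) (s : ℕ)
    (L : (ι →₀ MvPolynomial σ k) →ₗ[MvPolynomial σ k] (κ →₀ MvPolynomial σ k)) :
    ({x // τ x = s} →₀ MvPolynomial σ k) →ₗ[MvPolynomial σ k]
      ({x // τ' x = s} →₀ MvPolynomial σ k) :=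
  strandRes k σ τ' s ∘ₗ L ∘ₗ strandExt k σ τ s

theorem strandExt_strandMap {τ : ι → ℕ} {τ' : κ → ℕ} (s : ℕ)
    {L : (ι →₀ MvPolynomial σ k) →ₗ[MvPolynomial σ k] (κ →₀ MvPolynomial σ k)}
    (hL : IsGradedMap 0 τ τ' L) (f : {x // τ x = s} →₀ MvPolynomial σ k) :
    strandExt k σ τ' s (strandMap τ τ' s L f) = L (strandExt k σ τ s f) :=
  (hL _ _ (isHomog_strandExt τ s f)).strandExt_strandRes

theorem mem_range_strandMap {τ : ι → ℕ} {τ' : κ → ℕ} {s : ℕ}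
    {L : (ι →₀ MvPolynomial σ k) →ₗ[MvPolynomial σ k] (κ →₀ MvPolynomial σ k)}
    (hL : IsGradedMap 0 τ τ' L) (f : {x // τ' x = s} →₀ MvPolynomial σ k) :
    f ∈ LinearMap.range (strandMap τ τ' s L) ↔ strandExt k σ τ' s f ∈ LinearMap.range L := by
  constructor
  · rintro ⟨g, rfl⟩
    exact ⟨_, (strandExt_strandMap s hL g).symm⟩
  · intro h
    obtain ⟨g, hg, hg'⟩ := exists_isHomog_preimage
      (isComponentFamily_homogComponent (k := k) (0 : σ → ℕ) τ') L hL (isHomog_strandExt τ' s f) h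
    refine ⟨strandRes k σ τ s g, ?_⟩
    rw [strandMap, LinearMap.comp_apply, LinearMap.comp_apply, hg.strandExt_strandRes, hg',
      strandRes_strandExt]

theorem strandMap_exact {μ : Type*} {τ : ι → ℕ} {τ' : κ → ℕ} {τ'' : μ → ℕ} {s : ℕ}
    {L : (ι →₀ MvPolynomial σ k) →ₗ[MvPolynomial σ k] (κ →₀ MvPolynomial σ k)}
    {L' : (κ →₀ MvPolynomial σ k) →ₗ[MvPolynomial σ k] (μ →₀ MvPolynomial σ k)}
    (hL : IsGradedMap 0 τ τ' L) (hL' : IsGradedMap 0 τ' τ'' L')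
    (h : LinearMap.ker L' = LinearMap.range L) :
    LinearMap.ker (strandMap τ' τ'' s L') = LinearMap.range (strandMap τ τ' s L) := by
  ext f
  rw [mem_range_strandMap hL, ← h, LinearMap.mem_ker, LinearMap.mem_ker,
    ← strandExt_strandMap s hL']
  constructor
  · intro h
    rw [h, map_zero]
  · intro h
    rw [← strandRes_strandExt τ'' s (strandMap τ' τ'' s L' f), h, map_zero]

theorem isGradedMap_strandMap {w : σ → ℕ} {a : ι → ℕ} {b : κ → ℕ} {τ : ι → ℕ} {τ' : κ → ℕ}
    {s : ℕ} {L : (ι →₀ MvPolynomial σ k) →ₗ[MvPolynomial σ k] (κ →₀ MvPolynomial σ k)}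
    (hL : IsGradedMap w a b L) :
    IsGradedMap w (fun x => a x.1) (fun x => b x.1) (strandMap τ τ' s L) :=
  fun D _ hf q u hu => hL D _ hf.strandExt q.1 u hu

end Strand

section ComponentFamily

variable {k : Type*} [Field k] {σ : Type*} {ι κ : Type*} {M : Type*} [AddCommGroup M]
  [Module (MvPolynomial σ k) M]

theorem exists_isComponentFamily {w : σ → ℕ} {a : ι → ℕ} {b : κ → ℕ} {H : ℕ → Set M}
    {L : (ι →₀ MvPolynomial σ k) →ₗ[MvPolynomial σ k] (κ →₀ MvPolynomial σ k)}
    (hL : IsGradedMap w a b L) {ε : (κ →₀ MvPolynomial σ k) →ₗ[MvPolynomial σ k] M}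
    (hε : Function.Surjective ε) (hker : LinearMap.ker ε = LinearMap.range L)
    (hH : ∀ D x, x ∈ H D → ∃ f, IsHomog w b D f ∧ ε f = x) :
    ∃ c, IsComponentFamily H c := by
  have h : ∀ D, ε.toAddMonoidHom.ker ≤
      (ε.toAddMonoidHom.comp (homogComponent w b D)).ker := by
    intro D x hx
    have hx' : x ∈ LinearMap.range L := hker ▸ LinearMap.mem_ker.2 hx
    obtain ⟨y, rfl⟩ := hx'
    rw [AddMonoidHom.mem_ker, AddMonoidHom.comp_apply, ← hL.homogComponent]
    exact LinearMap.mem_ker.1 (hker ▸ ⟨_, rfl⟩)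
  refine ⟨fun D => ε.toAddMonoidHom.liftOfSurjective hε ⟨_, h D⟩, fun D D' x hx => ?_⟩
  obtain ⟨f, hf, rfl⟩ := hH D' x hx
  refine (AddMonoidHom.liftOfRightInverse_comp_apply ε.toAddMonoidHom _ _ ⟨_, h D⟩ f).trans ?_
  rw [AddMonoidHom.comp_apply, hf.homogComponent]
  split_ifs
  · rfl
  · exact map_zero ε

end ComponentFamily

section CoverIdeal

variable {k : Type*} [Field k] {n : ℕ}

/-- The map `k[X, T] → k[X]` sending `T_i` to the generator `∏_{j ≠ i} X_j` of the cover ideal of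
the complete graph. -/
noncomputable def coverEval (k : Type*) [Field k] (n : ℕ) :
    MvPolynomial (Fin n) (MvPolynomial (Fin n) k) →ₐ[MvPolynomial (Fin n) k]
      MvPolynomial (Fin n) k :=
  aeval fun i => ∏ j ∈ Finset.univ.erase i, X j

theorem coverEval_monomial (b : Fin n →₀ ℕ) (c : MvPolynomial (Fin n) k) :
    coverEval k n (monomial b c) = c * ∏ i, (∏ j ∈ Finset.univ.erase i, X j) ^ b i := by
  rw [coverEval, aeval_monomial, Finsupp.prod_fintype _ _ (by simp)]
  rfl

theorem toricMap_univ_X (o i : Fin n) :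
    toricMap k o Finset.univ (X i) = C (∏ j ∈ Finset.univ.erase i, X j) * X o := by
  rw [toricMap, aeval_X, toricExpT, toricExpX, if_pos (Finset.mem_univ i),
    if_pos (Finset.mem_univ i), show (X o : MvPolynomial (Fin n) (MvPolynomial (Fin n) k)) =
      monomial (Finsupp.single o 1) 1 from rfl, C_mul_monomial, mul_one, monomial_sum_one]
  rfl

theorem toricMap_univ_of_isHomogeneous (o : Fin n) {s : ℕ}
    {F : MvPolynomial (Fin n) (MvPolynomial (Fin n) k)} (hF : F.IsHomogeneous s) :
    toricMap k o Finset.univ F = C (coverEval k n F) * X o ^ s := by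
  conv_lhs => rw [F.as_sum]
  conv_rhs => rw [F.as_sum]
  rw [map_sum, map_sum, map_sum, Finset.sum_mul]
  refine Finset.sum_congr rfl fun b hb => ?_
  have hs : ∑ i, b i = s := by
    have := hF (mem_support_iff.1 hb)
    simpa [Finsupp.weight_apply, Finsupp.sum_fintype] using this
  rw [coverEval_monomial, monomial_eq, map_mul, Finsupp.prod_fintype _ _ (by simp), map_prod,
    ← hs, map_mul, map_prod, mul_assoc, ← Finset.prod_pow_eq_pow_sum, ← Finset.prod_mul_distrib]
  congr 1
  · exact AlgHom.commutes _ _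
  · refine Finset.prod_congr rfl fun i _ => ?_
    rw [map_pow, toricMap_univ_X, mul_pow, map_pow]

theorem coverEval_eq_zero_iff (o : Fin n) {s : ℕ}
    {F : MvPolynomial (Fin n) (MvPolynomial (Fin n) k)} (hF : F.IsHomogeneous s) :
    coverEval k n F = 0 ↔ F ∈ koszulIdeal k o Finset.univ := by
  rw [mem_koszulIdeal_iff (Finset.mem_univ o), toricMap_univ_of_isHomogeneous o hF,
    mul_eq_zero, or_iff_left (pow_ne_zero _ (X_ne_zero o)), C_eq_zero]

theorem isWeightedHomogeneous_prod_erase (w : Fin n → ℕ) (i : Fin n) :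
    IsWeightedHomogeneous w (∏ j ∈ Finset.univ.erase i, X j : MvPolynomial (Fin n) k)
      (∑ l, w l - w i) := by
  rw [← Finset.add_sum_erase _ w (Finset.mem_univ i), Nat.add_sub_cancel_left]
  exact IsWeightedHomogeneous.prod _ _ _ fun j _ => isWeightedHomogeneous_X k w j

theorem isWeightedHomogeneous_coverEval_monomial (w : Fin n → ℕ) (b : Fin n →₀ ℕ) :
    IsWeightedHomogeneous w (coverEval k n (monomial b 1)) (∑ i, b i * (∑ l, w l - w i)) := by
  rw [coverEval_monomial, one_mul]
  exact IsWeightedHomogeneous.prod _ _ _ fun i _ => (isWeightedHomogeneous_prod_erase w i).pow _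

theorem constantCoeff_eq_zero_of_mem_pow (hn : 2 ≤ n) {s : ℕ} (hs : 1 ≤ s)
    {f : MvPolynomial (Fin n) k}
    (hf : f ∈ Ideal.span (Set.range fun i : Fin n =>
      (∏ j ∈ Finset.univ.erase i, X j : MvPolynomial (Fin n) k)) ^ s) : constantCoeff f = 0 := by
  suffices h : Ideal.span (Set.range fun i : Fin n =>
      (∏ j ∈ Finset.univ.erase i, X j : MvPolynomial (Fin n) k)) ≤
        RingHom.ker (constantCoeff : MvPolynomial (Fin n) k →+* k) from
    h (Ideal.pow_le_self (by omega) hf)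
  rw [Ideal.span_le]
  rintro _ ⟨i, rfl⟩
  rw [SetLike.mem_coe, RingHom.mem_ker, map_prod]
  have : Nontrivial (Fin n) := Fin.nontrivial_iff_two_le.2 hn
  obtain ⟨j, hj⟩ := exists_ne i
  exact Finset.prod_eq_zero (Finset.mem_erase.2 ⟨hj, Finset.mem_univ j⟩) (constantCoeff_X k j)

end CoverIdeal

section PowerResolution

variable {k : Type*} [Field k] {n : ℕ}

namespace KoszulRes

variable {w : Fin n → ℕ} {W : ℕ} {o : Fin n} {R : Finset (Fin n)} (K : KoszulRes k w W o R)

theorem coeff_toPolynomial {ι : Type*} (e : ι ≃ (Fin n →₀ ℕ)) (x : ι)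
    (f : ι →₀ MvPolynomial (Fin n) k) : coeff (e x) (toPolynomial e f) = f x := by
  classical
  induction f using Finsupp.induction_linear with
  | zero => simp
  | add f g hf hg => rw [map_add, coeff_add, hf, hg, Finsupp.add_apply]
  | single y c =>
    rw [toPolynomial_single, coeff_monomial, Finsupp.single_apply]
    simp only [EmbeddingLike.apply_eq_iff_eq]

theorem isHomogeneous_toPolynomial {s : ℕ} {f : K.ι 0 →₀ MvPolynomial (Fin n) k}
    (hf : IsHomog 0 (K.τ 0) s f) : (toPolynomial K.e f).IsHomogeneous s := by
  classical
  conv => rw [← Finsupp.sum_single f, Finsupp.sum, map_sum]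
  refine IsHomogeneous.sum _ _ _ fun x hx => ?_
  rw [toPolynomial_single]
  refine isHomogeneous_monomial _ ?_
  rw [← isHomog_zero_iff.1 hf x (Finsupp.mem_support_iff.1 hx), K.τ_zero, Finsupp.degree_eq_sum]

theorem isHomog_of_isHomogeneous {s : ℕ} {f : K.ι 0 →₀ MvPolynomial (Fin n) k}
    (hf : (toPolynomial K.e f).IsHomogeneous s) : IsHomog 0 (K.τ 0) s f := by
  refine isHomog_zero_iff.2 fun x hx => ?_
  rw [← coeff_toPolynomial K.e] at hx
  rw [K.τ_zero, ← Finsupp.degree_eq_sum, ← hf hx, Finsupp.degree_eq_weight_one]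
  rfl

/-- The basis of the resolution of the `s`-th power of the cover ideal. -/
def powι (s : ℕ) : ℕ → Type
  | 0 => Unit
  | p + 1 => {x : K.ι p // K.τ p x = s}

/-- The degrees of the resolution of the `s`-th power of the cover ideal. -/
def powDeg (s : ℕ) : ∀ p, K.powι s p → ℕ
  | 0 => fun _ => 0
  | p + 1 => fun x => K.ω p x.1

/-- The differential of the resolution of the `s`-th power of the cover ideal. -/
noncomputable def powD (s : ℕ) : ∀ p, (K.powι s (p + 1) →₀ MvPolynomial (Fin n) k)
    →ₗ[MvPolynomial (Fin n) k] (K.powι s p →₀ MvPolynomial (Fin n) k)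
  | 0 => Finsupp.lsingle () ∘ₗ (coverEval k n).toLinearMap ∘ₗ (toPolynomial K.e).toLinearMap ∘ₗ
      strandExt k (Fin n) (K.τ 0) s
  | p + 1 => strandMap (K.τ (p + 1)) (K.τ p) s (K.d p)

/-- The augmentation of the resolution of the `s`-th power of the cover ideal. -/
noncomputable def powAug (s : ℕ) (I : Ideal (MvPolynomial (Fin n) k)) :
    (K.powι s 0 →₀ MvPolynomial (Fin n) k) →ₗ[MvPolynomial (Fin n) k]
      (MvPolynomial (Fin n) k ⧸ I) :=
  Submodule.mkQ I ∘ₗ Finsupp.lapply ()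

theorem powD_zero_apply (s : ℕ) (f : K.powι s 1 →₀ MvPolynomial (Fin n) k) :
    K.powD s 0 f () = coverEval k n (toPolynomial K.e (strandExt k (Fin n) (K.τ 0) s f)) :=
  Finsupp.single_eq_same

theorem powAug_apply (s : ℕ) (I : Ideal (MvPolynomial (Fin n) k))
    (f : K.powι s 0 →₀ MvPolynomial (Fin n) k) : K.powAug s I f = Ideal.Quotient.mk I (f ()) :=
  rfl

theorem powAug_surjective (s : ℕ) (I : Ideal (MvPolynomial (Fin n) k)) :
    Function.Surjective (K.powAug s I) := by
  intro x
  obtain ⟨f, rfl⟩ := Ideal.Quotient.mk_surjective x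
  exact ⟨Finsupp.single () f, congrArg (Ideal.Quotient.mk I) Finsupp.single_eq_same⟩

theorem mem_range_powD_zero (s : ℕ) (f : K.powι s 0 →₀ MvPolynomial (Fin n) k) :
    f ∈ LinearMap.range (K.powD s 0) ↔ f () ∈ Ideal.span (Set.range fun i : Fin n =>
      (∏ j ∈ Finset.univ.erase i, X j : MvPolynomial (Fin n) k)) ^ s := by
  rw [Ideal.mem_span_pow_iff_exists_isHomogeneous]
  constructor
  · rintro ⟨g, rfl⟩
    refine ⟨_, K.isHomogeneous_toPolynomial (isHomog_strandExt _ s g), ?_⟩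
    rw [powD_zero_apply, coverEval, aeval_eq_eval]
  · rintro ⟨p, hp, hpf⟩
    obtain ⟨g, rfl⟩ := (toPolynomial K.e).surjective p
    refine ⟨strandRes k (Fin n) (K.τ 0) s g, Finsupp.ext fun _ => ?_⟩
    refine (K.powD_zero_apply s _).trans ?_
    refine Eq.trans ?_ hpf
    rw [coverEval, aeval_eq_eval]
    exact congrArg _ (congrArg _ (K.isHomog_of_isHomogeneous hp).strandExt_strandRes)

theorem isGradedMap_powD (hW : W = ∑ l, w l) (s p : ℕ) :
    IsGradedMap w (K.powDeg s (p + 1)) (K.powDeg s p) (K.powD s p) := by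
  cases p with
  | zero =>
    refine isGradedMap_of_single fun q i u hu => ?_
    have hq : strandExt k (Fin n) (K.τ 0) s (Finsupp.single q 1) = Finsupp.single q.1 1 :=
      Finsupp.mapDomain_single
    have h := (K.powD_zero_apply s (Finsupp.single q 1)).trans
      (congrArg (coverEval k n ∘ toPolynomial K.e) hq)
    rw [Function.comp_apply, toPolynomial_single] at h
    have h' := isWeightedHomogeneous_coverEval_monomial (k := k) w (K.e q.1)
    rw [← h, ← hW, ← K.ω_zero] at h'
    exact h' hu
  | succ p => exact isGradedMap_strandMap (K.graded_ω p)

end KoszulRes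

variable {w : Fin n → ℕ} {W : ℕ} {o : Fin n}

theorem KoszulRes.isMinGradedRes (K : KoszulRes k w W o Finset.univ)
    (hW : W = ∑ l, w l) (hn : 2 ≤ n) {s : ℕ} (hs : 1 ≤ s)
    {I : Ideal (MvPolynomial (Fin n) k)}
    (hI : I = Ideal.span (Set.range fun i : Fin n => ∏ j ∈ Finset.univ.erase i, X j) ^ s) :
    IsMinGradedRes w (K.powDeg s) (fun D => {x | ∃ f ∈ weightedHomogeneousSubmodule k w D,
      Ideal.Quotient.mk I f = x}) (K.powD s) (K.powAug s I) where
  surj := K.powAug_surjective s I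
  ker_aug := by
    ext f
    rw [K.mem_range_powD_zero, ← hI, LinearMap.mem_ker, powAug_apply,
      Ideal.Quotient.eq_zero_iff_mem]
  exact i := by
    cases i with
    | zero =>
      ext f
      refine Iff.trans ?_ (mem_range_strandMap (K.graded_τ 0) f).symm
      rw [K.mem_range, ← coverEval_eq_zero_iff o
        (K.isHomogeneous_toPolynomial (isHomog_strandExt _ s f)), ← powD_zero_apply,
        LinearMap.mem_ker]
      constructor
      · intro h
        rw [h]
        rfl
      · intro h
        exact Finsupp.ext fun _ => h
    | succ i => exact strandMap_exact (K.graded_τ (i + 1)) (K.graded_τ i) (K.exact i)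
  min i f q := by
    cases i with
    | zero => exact constantCoeff_eq_zero_of_mem_pow hn hs ((K.mem_range_powD_zero s _).1 ⟨f, rfl⟩)
    | succ i => exact K.min i _ q.1
  graded := K.isGradedMap_powD hW s
  graded_aug D f hf := ⟨f (), fun u hu => hf () u hu, rfl⟩

theorem KoszulRes.exists_isComponentFamily_quotient
    (K : KoszulRes k w W o Finset.univ) (hW : W = ∑ l, w l) (hn : 2 ≤ n)
    {s : ℕ} (hs : 1 ≤ s) {I : Ideal (MvPolynomial (Fin n) k)}
    (hI : I = Ideal.span (Set.range fun i : Fin n => ∏ j ∈ Finset.univ.erase i, X j) ^ s) :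
    ∃ c, IsComponentFamily (fun D => {x | ∃ f ∈ weightedHomogeneousSubmodule k w D,
      Ideal.Quotient.mk I f = x}) c := by
  refine exists_isComponentFamily (K.isGradedMap_powD hW s 0) (K.powAug_surjective s I)
    (K.isMinGradedRes hW hn hs hI).ker_aug ?_
  rintro D _ ⟨f, hf, rfl⟩
  refine ⟨Finsupp.single () f, fun i u hu => hf fun h => hu ?_,
    congrArg (Ideal.Quotient.mk I) Finsupp.single_eq_same⟩
  exact (congrArg (coeff u) Finsupp.single_eq_same).trans h

end PowerResolution

theorem homogOfDeg_iff_isHomog {k : Type*} [Field k] {n : ℕ} {w : Fin n → ℕ} {βi : ℕ → ℕ}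
    {D : ℕ} {f : ((j : ℕ) × Fin (βi j)) →₀ MvPolynomial (Fin n) k} :
    HomogOfDeg k n w βi D f ↔ IsHomog w Sigma.fst D f := by
  constructor
  · intro h q u hu
    have h1 : Finsupp.weight w u = D - q.1 := (h q).1 hu
    have h2 : ¬ D < q.1 := fun hlt => hu (by rw [(h q).2 hlt, coeff_zero])
    omega
  · intro h q
    refine ⟨fun u hu => ?_, fun hlt => ?_⟩
    · have := h q u hu
      omega
    · ext u
      by_contra hu
      have := h q u hu
      omega

theorem IsMinimalGradedFreeResolution.exists_isMinGradedRes {k : Type*} [Field k] {n : ℕ}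
    {w : Fin n → ℕ} {β : ℕ → ℕ → ℕ} {M : Type*} [AddCommGroup M] [Module (MvPolynomial (Fin n) k) M]
    {H : ℕ → Set M} (h : IsMinimalGradedFreeResolution k n w β M H) :
    ∃ (d : ∀ i, (((j : ℕ) × Fin (β (i + 1) j)) →₀ MvPolynomial (Fin n) k)
        →ₗ[MvPolynomial (Fin n) k] (((j : ℕ) × Fin (β i j)) →₀ MvPolynomial (Fin n) k))
      (ε : (((j : ℕ) × Fin (β 0 j)) →₀ MvPolynomial (Fin n) k) →ₗ[MvPolynomial (Fin n) k] M),
      IsMinGradedRes w (ι := fun i => (j : ℕ) × Fin (β i j)) (fun _ => Sigma.fst) H d ε := by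
  obtain ⟨d, ε, hsurj, hker, hexact, hmin, hgraded, haug⟩ := h
  refine ⟨d, ε, hsurj, hker, hexact, fun i f q => ?_, fun i D f hf => ?_, fun D f hf => ?_⟩
  · exact constantCoeff_apply_eq_zero (d i) q f fun p => Or.inr (hmin i p q)
  · exact homogOfDeg_iff_isHomog.1 (hgraded i D f (homogOfDeg_iff_isHomog.2 hf))
  · exact haug D f (homogOfDeg_iff_isHomog.2 hf)

/-- Let `S = k[X_1,…,X_n]` be graded by weights `w 0 ≤ w 1 ≤ ⋯` on the
variables and let `J(K_n) = ⟨X_1⋯X_n/X_i : i⟩` be the cover ideal of the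
complete graph.  The (weighted) Castelnuovo–Mumford regularity of `S/J(K_n)^s`,
read off from the graded Betti numbers `β i j` of any minimal graded free
resolution as `max {j - i : β i j ≠ 0}`, equals `s·∑ w_l - (s+1)` if
`s < n - 1` and `s·∑ w_l - w_1(s-n+1) - n` if `s ≥ n - 1`. -/
theorem regularity_power_cover_ideal_complete_graph_weighted
    {k : Type*} [Field k] (n s : ℕ) (hn : 2 ≤ n) (hs : 1 ≤ s)
    (w : Fin n → ℕ) (hw1 : ∀ i, 1 ≤ w i) (hmono : Monotone w)
    (J : Ideal (MvPolynomial (Fin n) k))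
    (hJ : J = Ideal.span (Set.range fun i : Fin n =>
        ∏ j ∈ Finset.univ.erase i, X j))
    (β : ℕ → ℕ → ℕ)
    (hβ : IsMinimalGradedFreeResolution k n w β
      (MvPolynomial (Fin n) k ⧸ (J ^ s))
      (fun dg => {x | ∃ f ∈ weightedHomogeneousSubmodule k w dg,
        Ideal.Quotient.mk (J ^ s) f = x}))
    (R : ℕ)
    (hR : R = if s < n - 1 then s * (∑ l, w l) - (s + 1)
      else s * (∑ l, w l) - w ⟨0, by omega⟩ * (s + 1 - n) - n) :
    (∀ i j, β i j ≠ 0 → j ≤ i + R) ∧ ∃ i j, β i j ≠ 0 ∧ j = i + R := by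
  set v := w ⟨0, by omega⟩ with hv
  set W := ∑ l, w l with hW_def
  have hw0 : ∀ i, v ≤ w i := fun i => hmono (Fin.mk_le_of_le_val (Nat.zero_le _))
  have hW : ∀ i, w i ≤ W := fun i => Finset.single_le_sum_of_canonicallyOrdered
    (Finset.mem_univ i)
  obtain ⟨K⟩ := nonempty_koszulRes k hW hw0
  have hI := congrArg (· ^ s) hJ
  obtain ⟨c, hc⟩ := K.exists_isComponentFamily_quotient rfl hn hs hI
  have hG := K.isMinGradedRes rfl hn hs hI
  obtain ⟨d, ε, hF⟩ := hβ.exists_isMinGradedRes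
  have hsum : v + (n - 1) ≤ W := by
    rw [hW_def, ← Finset.add_sum_erase _ w (Finset.mem_univ ⟨0, by omega⟩)]
    refine Nat.add_le_add_left ?_ _
    calc n - 1 = ∑ l ∈ Finset.univ.erase (⟨0, by omega⟩ : Fin n), 1 := by simp
      _ ≤ _ := Finset.sum_le_sum fun l _ => hw1 l
  have hpos : 1 ≤ v := hw1 _
  have hlow : s * W = s * v + s * (n - 1) + s * (W - v - (n - 1)) := by
    rw [← mul_add, ← mul_add]
    congr 1
    omega
  have hsn : n - 1 ≤ s * (n - 1) := Nat.le_mul_of_pos_left _ hs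
  have hsv : s ≤ s * v := Nat.le_mul_of_pos_right _ hpos
  have hvn : n - 1 ≤ s → s * v = v * (s + 1 - n) + (n - 1) * v := fun h => by
    rw [mul_comm v, ← add_mul]
    congr 1
    omega
  have hnv : n - 1 ≤ (n - 1) * v := Nat.le_mul_of_pos_right _ hpos
  constructor
  · intro i j hij
    obtain ⟨q, rfl⟩ := hF.exists_degree_eq hc hG i ⟨j, ⟨0, Nat.pos_of_ne_zero hij⟩⟩
    cases i with
    | zero => exact Nat.zero_le _
    | succ p =>
      obtain ⟨x, hx⟩ := q
      have hp := K.lt_card p x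
      have hps := K.le_τ p x
      have hω := K.ω_le p x
      rw [hx, ← hv] at hω
      rw [hx] at hps
      rw [Finset.card_univ, Fintype.card_fin] at hp
      change K.ω p x ≤ p + 1 + R
      split_ifs at hR with hcase
      · have := Nat.le_mul_of_pos_right (s - p) hpos
        omega
      · have h1 : (s - p) * v = v * (s + 1 - n) + (n - 1 - p) * v := by
          rw [mul_comm v, ← add_mul]
          congr 1
          omega
        have := Nat.le_mul_of_pos_right (n - 1 - p) hpos
        omega
  · have key : ∀ p, p < n → p ≤ s → ∃ j, β (p + 1) j ≠ 0 ∧ j + (s - p) * v = s * W := by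
      intro p hp hps
      obtain ⟨x, hx, hx'⟩ := K.exists_ω_eq p s (by simpa using hp) hps
      obtain ⟨⟨j, q⟩, hq⟩ := hG.exists_degree_eq hc hF (p + 1) ⟨x, hx⟩
      refine ⟨j, fun h0 => (h0 ▸ q).elim0, ?_⟩
      rw [← hx', ← hv]
      exact congrArg (· + (s - p) * v) hq
    split_ifs at hR with hcase
    · obtain ⟨j, hj, hj'⟩ := key s (by omega) le_rfl
      refine ⟨s + 1, j, hj, ?_⟩
      rw [Nat.sub_self, zero_mul] at hj'
      omega
    · obtain ⟨j, hj, hj'⟩ := key (n - 1) (by omega) (by omega)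
      refine ⟨n - 1 + 1, j, hj, ?_⟩
      rw [show s - (n - 1) = s + 1 - n by omega, mul_comm] at hj'
      omega
end
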